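/- arXiv:2212.05528 — 9 statements merged into one kernel-verified Lean document; each statement's English description precedes it below -/
import Mathlib

section
/- Let ℓ, μ, r be positive integers, set g = ℓμ and n = gr. Let a = (a_1,...,a_ℓ) in (F_{q^m}^*)^ℓ with N_{F_{q^m}/F_q}(a_i) ≠ N_{F_{q^m}/F_q}(a_j) for i ≠ j, and let β = (β_1,...,β_{μr}) in F_{q^m}^{μr}. For k in [gr], the code C_k(a,β) generated by the extended Moore matrix M_k(a,β) (rows indexed by s = 0,...,k−1 with entries β_u^{q^s} a_i^{(q^s−1)/(q−1)}) is MSRD over F_q for the length partition (g,r) if, and only if, the code D_k(a,β) generated by the shifted matrix M'_k(a,β) (rows indexed by s = 1,...,k with entries β_u^{q^s} a_i^{(q^s−1)/(q−1)}) is MSRD over F_q for the length partition (g,r). -/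
/-- The minimum distance of a code `C` with respect to a distance function `d`. -/
noncomputable def minDist {V : Type*} (d : V → V → ℕ) (C : Set V) : ℕ :=
  sInf {x | ∃ c ∈ C, ∃ c' ∈ C, c ≠ c' ∧ x = d c c'}

/-- The field norm `N_{F_{q^m}/F_q}(x) = x · x^q ⋯ x^{q^{m-1}}`. -/
def fieldNorm (q m : ℕ) {F : Type*} [Field F] (x : F) : F :=
  ∏ i ∈ Finset.range m, x ^ q ^ i

/-- The rank weight over `F_q` of a vector in `F_{q^m}^r`:
`wt_R(d₁,...,d_r) = dim_{F_q}⟨d₁,...,d_r⟩`. -/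
noncomputable def rkWt {F : Type*} [Field F] (Fq : Subfield F) {r : ℕ} (v : Fin r → F) : ℕ :=
  Module.finrank Fq (Submodule.span Fq (Set.range v))

/-- The sum-rank weight over `F_q` for the length partition `(ℓ·μ, r)`, where the blocks of
length `r` are indexed by pairs `(i, j) ∈ [ℓ] × [μ]`. -/
noncomputable def srWt {F : Type*} [Field F] (Fq : Subfield F) {l μ r : ℕ}
    (c : Fin l → Fin μ → Fin r → F) : ℕ :=
  ∑ i, ∑ j, rkWt Fq (c i j)

/-- The minimum distance is invariant under injective distance-preserving maps. -/
theorem minDist_image {V W : Type*} (d : V → V → ℕ) (d' : W → W → ℕ) {f : V → W}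
    (hf : Function.Injective f) (hd : ∀ x y, d' (f x) (f y) = d x y) (C : Set V) :
    minDist d' (f '' C) = minDist d C := by
  simp [minDist, hd, hf.ne_iff]

/-- The rank weight is invariant under injective `F_q`-linear maps. -/
theorem rkWt_comp {F : Type*} [Field F] (Fq : Subfield F) {r : ℕ} {f : F →ₗ[Fq] F}
    (hf : Function.Injective f) (v : Fin r → F) : rkWt Fq (f ∘ v) = rkWt Fq v := by
  rw [rkWt, rkWt, Set.range_comp, Submodule.span_image]
  exact (Submodule.equivMapOfInjective f hf _).symm.finrank_eq

/-- The rank weight is invariant under applying an `F_q`-automorphism and then scaling. -/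
theorem rkWt_mul_algEquiv {F : Type*} [Field F] (Fq : Subfield F) {r : ℕ} (σ : F ≃ₐ[Fq] F)
    {b : F} (hb : b ≠ 0) (v : Fin r → F) : rkWt Fq (fun u => b * σ (v u)) = rkWt Fq v :=
  rkWt_comp Fq (f := LinearMap.mulLeft Fq b ∘ₗ σ.toLinearMap)
    ((mul_right_injective₀ hb).comp σ.injective) v

/-- The semilinear map applying `σ` to every coordinate and multiplying block row `i` by `a i`. -/
def twistedScale {F : Type*} [Field F] (σ : F ≃+* F) {l μ r : ℕ} (a : Fin l → F) :
    (Fin l → Fin μ → Fin r → F) →ₛₗ[(σ : F →+* F)] (Fin l → Fin μ → Fin r → F) where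
  toFun c i j u := a i * σ (c i j u)
  map_add' c d := by
    ext
    simp [mul_add]
  map_smul' x c := by
    ext
    simp [mul_left_comm]

theorem twistedScale_injective {F : Type*} [Field F] (σ : F ≃+* F) {l μ r : ℕ} {a : Fin l → F}
    (ha : ∀ i, a i ≠ 0) : Function.Injective (twistedScale (μ := μ) (r := r) σ a) := by
  intro c d h
  ext i j u
  exact σ.injective (mul_left_cancel₀ (ha i) (congrFun (congrFun (congrFun h i) j) u))

/-- Injective maps semilinear over a field automorphism preserve dimensions of subspaces. -/
theorem finrank_map_semilinear {F V W : Type*} [Field F] [AddCommGroup V] [Module F V]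
    [AddCommGroup W] [Module F W] (σ : F ≃+* F) (f : V →ₛₗ[(σ : F →+* F)] W)
    (hf : Function.Injective f) (C : Submodule F V) :
    Module.finrank F (C.map f) = Module.finrank F C := by
  let e : C ≃+ C.map f :=
    { Equiv.Set.image f C hf with
      map_add' := fun x y => Subtype.ext (map_add f (x : V) y) }
  have h := lift_rank_eq_of_equiv_equiv σ e σ.bijective
    fun x c => Subtype.ext (map_smulₛₗ f x (c : V))
  simpa [Module.finrank] using congrArg Cardinal.toNat h.symm

/-- **Lemma.**  Let `g = ℓμ`, `n = gr`, let `a : Fin ℓ → F_{q^m}` have nonzero entries with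
pairwise distinct norms, and let `β : [μ] × [r] → F_{q^m}`.  For `k ∈ [gr]`, the code
`C_k(a, β)` generated by the extended Moore matrix `M_k(a, β)` (rows `s = 0, ..., k-1`, entries
`β_u^{q^s} a_i^{(q^s-1)/(q-1)}`) is MSRD over `F_q` for the length partition `(g, r)` if and
only if the code `D_k(a, β)` generated by the shifted matrix `M'_k(a, β)` (rows
`s = 1, ..., k`) is MSRD over `F_q` for the length partition `(g, r)`. -/
theorem moore_code_MSRD_iff_shifted_moore_code_MSRD
    {q m l μ r : ℕ} (hl : 1 ≤ l) (hμ : 1 ≤ μ) (hr : 1 ≤ r)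
    {F : Type*} [Field F] [Finite F]
    (Fq : Subfield F) (hq : Nat.card Fq = q) (hF : Nat.card F = q ^ m)
    (a : Fin l → F) (ha0 : ∀ i, a i ≠ 0)
    (haN : ∀ i j, i ≠ j → fieldNorm q m (a i) ≠ fieldNorm q m (a j))
    (β : Fin μ → Fin r → F)
    (k : ℕ) (hk1 : 1 ≤ k) (hkn : k ≤ l * μ * r)
    (Ck Dk : Submodule F (Fin l → Fin μ → Fin r → F))
    (hCk : Ck = Submodule.span F (Set.range (fun s : Fin k =>
      fun (i : Fin l) (j : Fin μ) (u : Fin r) =>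
        β j u ^ q ^ (s : ℕ) * a i ^ (∑ e ∈ Finset.range (s : ℕ), q ^ e))))
    (hDk : Dk = Submodule.span F (Set.range (fun s : Fin k =>
      fun (i : Fin l) (j : Fin μ) (u : Fin r) =>
        β j u ^ q ^ ((s : ℕ) + 1) * a i ^ (∑ e ∈ Finset.range ((s : ℕ) + 1), q ^ e)))) :
    (Module.finrank F Ck = k ∧
        minDist (fun c c' : Fin l → Fin μ → Fin r → F => srWt Fq (c - c')) (Ck : Set _)
          = l * μ * r - k + 1)
    ↔ (Module.finrank F Dk = k ∧
        minDist (fun c c' : Fin l → Fin μ → Fin r → F => srWt Fq (c - c')) (Dk : Set _)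
          = l * μ * r - k + 1) := by
  have := Fintype.ofFinite F
  have := Fintype.ofFinite Fq
  let σ : F ≃ₐ[Fq] F := FiniteField.frobeniusAlgEquivOfAlgebraic Fq F
  have hσ : ∀ x, σ x = x ^ q := fun x => by
    simp [σ, ← hq, Nat.card_eq_fintype_card]
  let f := twistedScale (μ := μ) (r := r) (σ : F ≃+* F) a
  have hf : Function.Injective f := twistedScale_injective _ ha0
  have hmap : Dk = Ck.map f := by
    rw [hCk, hDk, Submodule.map_span, ← Set.range_comp]
    congr 2
    ext s i j u
    change _ = a i * σ _
    rw [hσ, Finset.sum_range_succ']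
    simp only [pow_succ, ← Finset.sum_mul, pow_zero, pow_mul, mul_pow]
    ring
  have hd : ∀ c c', srWt Fq (f c - f c') = srWt Fq (c - c') := fun c c' => by
    rw [← map_sub]
    exact Finset.sum_congr rfl fun i _ => Finset.sum_congr rfl fun j _ =>
      rkWt_mul_algEquiv Fq σ (ha0 i) _
  rw [hmap, finrank_map_semilinear _ f hf, Submodule.map_coe, minDist_image _ _ hf hd]
end

section
/- Let ℓ, μ, r be positive integers, set g = ℓμ and n = gr. Let a = (a_1,...,a_ℓ) in (F_{q^m}^*)^ℓ with N_{F_{q^m}/F_q}(a_i) ≠ N_{F_{q^m}/F_q}(a_j) for i ≠ j, and let β = (β_1,...,β_{μr}) in F_{q^m}^{μr}. For k with 2 ≤ k ≤ n, the code C_k(a,β) ⊆ F_{q^m}^n generated by the extended Moore matrix M_k(a,β) is MSRD over F_q for the length partition (g,r) if, and only if, the doubly extended code C^e_k(a,β) ⊆ F_{q^m}^{n+2}, generated by the matrix obtained from M_k(a,β) by appending two columns equal to (1,0,...,0)ᵀ and (0,...,0,1)ᵀ, attains the Singleton bound d_e(C^e_k(a,β)) = (n+2) − k + 1 for the extended sum-rank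 metric d_e((c,c_{n+1},c_{n+2}),(d,d_{n+1},d_{n+2})) = d_SR(c,d) + d_H((c_{n+1},c_{n+2}),(d_{n+1},d_{n+2})). -/
theorem rkWt_comp_le {F : Type*} [Field F] [Finite F] (Fq : Subfield F) {r : ℕ}
    (φ : F →ₗ[Fq] F) (v : Fin r → F) : rkWt Fq (fun u => φ (v u)) ≤ rkWt Fq v := by
  have h : Set.range (fun u => φ (v u)) = φ '' Set.range v := Set.range_comp φ v
  unfold rkWt
  rw [h, Submodule.span_image]
  exact Submodule.finrank_map_le φ _

theorem rkWt_comp_of_injective {F : Type*} [Field F] (Fq : Subfield F) {r : ℕ}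
    (φ : F →ₗ[Fq] F) (hφ : Function.Injective φ) (v : Fin r → F) :
    rkWt Fq (fun u => φ (v u)) = rkWt Fq v := by
  have h : Set.range (fun u => φ (v u)) = φ '' Set.range v := Set.range_comp φ v
  unfold rkWt
  rw [h, Submodule.span_image]
  exact (Submodule.equivMapOfInjective φ hφ _).finrank_eq.symm

theorem rkWt_comp_lt {F : Type*} [Field F] [Finite F] (Fq : Subfield F) {r : ℕ}
    (φ : F →ₗ[Fq] F) (v : Fin r → F) {u : Fin r} (hu : v u ≠ 0) (hφ : φ (v u) = 0) :
    rkWt Fq (fun u => φ (v u)) < rkWt Fq v := by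
  have h : Set.range (fun u => φ (v u)) = φ '' Set.range v := Set.range_comp φ v
  unfold rkWt
  rw [h, Submodule.span_image]
  set p := Submodule.span Fq (Set.range v) with hp
  have hmem : v u ∈ p := Submodule.subset_span ⟨u, rfl⟩
  have hrank := LinearMap.finrank_range_add_finrank_ker (φ.domRestrict p)
  have hrange : LinearMap.range (φ.domRestrict p) = p.map φ := by
    rw [LinearMap.range_domRestrict]
  rw [hrange] at hrank
  have hker : 0 < Module.finrank Fq (LinearMap.ker (φ.domRestrict p)) := by
    refine Nat.pos_of_ne_zero fun h0 => ?_
    have hbot := Submodule.finrank_eq_zero.1 h0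
    have hz : (⟨v u, hmem⟩ : p) ∈ LinearMap.ker (φ.domRestrict p) := hφ
    rw [hbot, Submodule.mem_bot] at hz
    exact hu (congrArg Subtype.val hz)
  omega

theorem rkWt_le_card_support {F : Type*} [Field F] [DecidableEq F] (Fq : Subfield F) {r : ℕ}
    (v : Fin r → F) : rkWt Fq v ≤ ∑ u, if v u ≠ 0 then 1 else 0 := by
  have hle : Submodule.span Fq (Set.range v) ≤
      Submodule.span Fq ((Finset.univ.filter (fun u => v u ≠ 0)).image v : Set F) := by
    rw [Submodule.span_le]
    rintro _ ⟨u, rfl⟩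
    by_cases hu : v u = 0
    · rw [hu]; exact Submodule.zero_mem _
    · refine Submodule.subset_span ?_
      rw [Finset.coe_image]
      exact ⟨u, by simpa using hu, rfl⟩
  calc rkWt Fq v ≤ Module.finrank Fq (Submodule.span Fq
        ((Finset.univ.filter (fun u => v u ≠ 0)).image v : Set F)) :=
        Submodule.finrank_mono hle
    _ ≤ ((Finset.univ.filter (fun u => v u ≠ 0)).image v).card := finrank_span_finset_le_card _
    _ ≤ (Finset.univ.filter (fun u => v u ≠ 0)).card := Finset.card_image_le
    _ = _ := Finset.card_filter _ _

theorem rkWt_zero {F : Type*} [Field F] (Fq : Subfield F) {r : ℕ} {v : Fin r → F}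
    (hv : ∀ u, v u = 0) : rkWt Fq v = 0 := by
  have h : Submodule.span Fq (Set.range v) = ⊥ := by
    rw [Submodule.span_eq_bot]
    rintro _ ⟨u, rfl⟩
    exact hv u
  unfold rkWt
  rw [h, finrank_bot]

theorem srWt_zero {F : Type*} [Field F] (Fq : Subfield F) {l μ r : ℕ} :
    srWt Fq (0 : Fin l → Fin μ → Fin r → F) = 0 :=
  Finset.sum_eq_zero fun _ _ => Finset.sum_eq_zero fun _ _ => rkWt_zero Fq fun _ => rfl

theorem srWt_le_card_support {F : Type*} [Field F] [DecidableEq F] (Fq : Subfield F) {l μ r : ℕ}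
    (c : Fin l → Fin μ → Fin r → F) :
    srWt Fq c ≤ (Finset.univ.filter
      (fun x : Fin l × Fin μ × Fin r => c x.1 x.2.1 x.2.2 ≠ 0)).card := by
  rw [Finset.card_filter, Fintype.sum_prod_type]
  refine Finset.sum_le_sum fun i _ => ?_
  rw [Fintype.sum_prod_type]
  exact Finset.sum_le_sum fun j _ => rkWt_le_card_support Fq (c i j)

/-- Blockwise linear maps, one of which kills a nonzero entry, lower the sum-rank weight. -/
theorem srWt_comp_lt {F : Type*} [Field F] [Finite F] (Fq : Subfield F) {l μ r : ℕ}
    (φ : Fin l → F →ₗ[Fq] F) (c : Fin l → Fin μ → Fin r → F) {i : Fin l} {j : Fin μ} {u : Fin r}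
    (hu : c i j u ≠ 0) (hφ : φ i (c i j u) = 0) :
    srWt Fq (fun i j u => φ i (c i j u)) < srWt Fq c := by
  refine Finset.sum_lt_sum (fun i _ => Finset.sum_le_sum fun j _ => rkWt_comp_le Fq (φ i) _)
    ⟨i, Finset.mem_univ _, Finset.sum_lt_sum (fun j _ => rkWt_comp_le Fq (φ i) _)
      ⟨j, Finset.mem_univ _, rkWt_comp_lt Fq (φ i) (c i j) hu hφ⟩⟩

theorem srWt_comp_of_injective {F : Type*} [Field F] (Fq : Subfield F) {l μ r : ℕ}
    (φ : Fin l → F →ₗ[Fq] F) (hφ : ∀ i, Function.Injective (φ i))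
    (c : Fin l → Fin μ → Fin r → F) :
    srWt Fq (fun i j u => φ i (c i j u)) = srWt Fq c :=
  Finset.sum_congr rfl fun i _ => Finset.sum_congr rfl fun j _ =>
    rkWt_comp_of_injective Fq (φ i) (hφ i) (c i j)

/-- A linear code given by `k` generators attains the distance `D`, an a priori upper bound, with
full dimension if and only if all nonzero combinations of the generators have weight at least
`D`. -/
theorem finrank_and_minDist_iff {F V : Type*} [Field F] [AddCommGroup V] [Module F V] {k D : ℕ}
    (v : Fin k → V) (w : V → ℕ) (hw : w 0 = 0) (hD : 1 ≤ D)
    (hS : ∃ f : Fin k → F, f ≠ 0 ∧ w (∑ s, f s • v s) ≤ D) :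
    (Module.finrank F (Submodule.span F (Set.range v)) = k ∧
      minDist (fun c c' => w (c - c')) (Submodule.span F (Set.range v) : Set V) = D) ↔
    ∀ f : Fin k → F, f ≠ 0 → D ≤ w (∑ s, f s • v s) := by
  constructor
  · rintro ⟨hk, hd⟩ f hf
    have hli : LinearIndependent F v := by
      rw [linearIndependent_iff_card_eq_finrank_span, Fintype.card_fin]
      exact hk.symm
    rw [← hd]
    refine Nat.sInf_le ⟨∑ s, f s • v s, ?_, 0, Submodule.zero_mem _, ?_, by simp⟩
    · exact Submodule.sum_mem _ fun s _ =>
        Submodule.smul_mem _ _ (Submodule.subset_span ⟨s, rfl⟩)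
    · intro h0
      exact hf (funext (Fintype.linearIndependent_iff.1 hli f h0))
  · intro h
    have hli : LinearIndependent F v := by
      rw [Fintype.linearIndependent_iff]
      intro f hf
      by_contra! hne
      obtain ⟨s, hs⟩ := hne
      have := h f (fun h0 => hs (congrFun h0 s))
      rw [hf, hw] at this
      omega
    refine ⟨by simpa using finrank_span_eq_card hli, ?_⟩
    have hlow : ∀ x ∈ {x | ∃ c ∈ (Submodule.span F (Set.range v) : Set V),
        ∃ c' ∈ (Submodule.span F (Set.range v) : Set V), c ≠ c' ∧ x = w (c - c')}, D ≤ x := by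
      rintro _ ⟨c, hc, c', hc', hne, rfl⟩
      obtain ⟨f, hf⟩ := (Submodule.mem_span_range_iff_exists_fun F).1 (Submodule.sub_mem _ hc hc')
      rw [← hf]
      refine h f ?_
      rintro rfl
      apply hne
      rw [← sub_eq_zero, ← hf]
      simp
    obtain ⟨f, hf, hle⟩ := hS
    have hmem : w (∑ s, f s • v s) ∈ {x | ∃ c ∈ (Submodule.span F (Set.range v) : Set V),
        ∃ c' ∈ (Submodule.span F (Set.range v) : Set V), c ≠ c' ∧ x = w (c - c')} := by
      refine ⟨∑ s, f s • v s, ?_, 0, Submodule.zero_mem _, ?_, by simp⟩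
      · exact Submodule.sum_mem _ fun s _ =>
          Submodule.smul_mem _ _ (Submodule.subset_span ⟨s, rfl⟩)
      · intro h0
        exact hf (funext (Fintype.linearIndependent_iff.1 hli f h0))
    exact le_antisymm ((Nat.sInf_le hmem).trans hle) (hlow _ (Nat.sInf_mem ⟨_, hmem⟩))

/-- The Singleton bound for the sum-rank metric, in terms of generators. -/
theorem exists_srWt_le {F : Type*} [Field F] (Fq : Subfield F) {l μ r k : ℕ}
    (hk : 1 ≤ k) (hkn : k ≤ l * μ * r) (v : Fin k → Fin l → Fin μ → Fin r → F) :
    ∃ f : Fin k → F, f ≠ 0 ∧ srWt Fq (∑ s, f s • v s) ≤ l * μ * r - k + 1 := by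
  classical
  have hcard : (Finset.univ : Finset (Fin l × Fin μ × Fin r)).card = l * μ * r := by
    simp [mul_assoc]
  obtain ⟨S, -, hS⟩ := Finset.exists_subset_card_eq (s := (Finset.univ : Finset
    (Fin l × Fin μ × Fin r))) (n := k - 1) (by omega)
  let T : (Fin k → F) →ₗ[F] (S → F) :=
    { toFun := fun f x => (∑ s, f s • v s) x.1.1 x.1.2.1 x.1.2.2
      map_add' := fun f g => by
        ext x; simp [add_mul, Finset.sum_add_distrib, Finset.sum_apply]
      map_smul' := fun b f => by
        ext x; simp [Finset.mul_sum, mul_assoc, Finset.sum_apply] }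
  have hker : LinearMap.ker T ≠ ⊥ := LinearMap.ker_ne_bot_of_finrank_lt (by
    simp only [Module.finrank_fintype_fun_eq_card, Fintype.card_coe, Fintype.card_fin]; omega)
  obtain ⟨f, hf, hf0⟩ := Submodule.exists_mem_ne_zero_of_ne_bot hker
  refine ⟨f, hf0, (srWt_le_card_support Fq _).trans ?_⟩
  have hsub : Finset.univ.filter (fun x : Fin l × Fin μ × Fin r =>
      (∑ s, f s • v s) x.1 x.2.1 x.2.2 ≠ 0) ⊆ Finset.univ \ S := by
    intro x hx
    simp only [Finset.mem_filter, Finset.mem_univ, true_and, Finset.mem_sdiff] at hx ⊢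
    intro hxS
    exact hx (congrFun (LinearMap.mem_ker.1 hf) ⟨x, hxS⟩)
  have hle := Finset.card_le_card hsub
  rw [Finset.card_sdiff_of_subset (Finset.subset_univ S), hcard, hS] at hle
  omega

/-- The `F_q`-linear operator `x ↦ a x^q - b x`. -/
noncomputable def twistedFrobenius {F : Type*} [Field F] [Finite F] (Fq : Subfield F)
    (a b : F) : F →ₗ[Fq] F :=
  letI := Fintype.ofFinite Fq
  LinearMap.mulLeft Fq a ∘ₗ (FiniteField.frobeniusAlgHom Fq F).toLinearMap - LinearMap.mulLeft Fq b

theorem twistedFrobenius_apply {F : Type*} [Field F] [Finite F] (Fq : Subfield F) (a b x : F) :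
    twistedFrobenius Fq a b x = a * x ^ Nat.card Fq - b * x := by
  let := Fintype.ofFinite Fq
  rw [Nat.card_eq_fintype_card]
  simp [twistedFrobenius]

theorem twistedFrobenius_zero_injective {F : Type*} [Field F] [Finite F] (Fq : Subfield F) {a : F}
    (ha : a ≠ 0) : Function.Injective (twistedFrobenius Fq a 0) := by
  rw [injective_iff_map_eq_zero]
  intro x hx
  rw [twistedFrobenius_apply, zero_mul, sub_zero] at hx
  exact eq_zero_of_pow_eq_zero ((mul_eq_zero.1 hx).resolve_left ha)

/-- The value at `β` of the operator `∑_{s<k} f_s D_a^s`, where `D_a x = a x^q`. -/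
def mooreEval {F : Type*} [Field F] (q k : ℕ) (f : ℕ → F) (a β : F) : F :=
  ∑ s ∈ Finset.range k, f s * (β ^ q ^ s * a ^ (∑ e ∈ Finset.range s, q ^ e))

/-- The coefficients of `(D - b) ∘ f`. -/
def mooreMul {F : Type*} [Field F] (q : ℕ) (b : F) (f : ℕ → F) (s : ℕ) : F :=
  (if s = 0 then 0 else f (s - 1) ^ q) - b * f s

theorem mooreEval_mooreMul {F : Type*} [Field F] [Finite F] (Fq : Subfield F) {k : ℕ}
    {f : ℕ → F} (hf : f k = 0) (a b β : F) :
    mooreEval (Nat.card Fq) (k + 1) (mooreMul (Nat.card Fq) b f) a β =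
      twistedFrobenius Fq a b (mooreEval (Nat.card Fq) (k + 1) f a β) := by
  set q := Nat.card Fq with hq
  have hfrob : ∀ x : F, twistedFrobenius Fq 1 0 x = x ^ q := fun x => by
    rw [twistedFrobenius_apply]; ring
  have hsum : (mooreEval q (k + 1) f a β) ^ q =
      ∑ s ∈ Finset.range k, (f s * (β ^ q ^ s * a ^ (∑ e ∈ Finset.range s, q ^ e))) ^ q := by
    rw [← hfrob, mooreEval, Finset.sum_range_succ, hf, zero_mul, add_zero, map_sum]
    exact Finset.sum_congr rfl fun s _ => hfrob _
  rw [twistedFrobenius_apply, hsum]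
  simp only [mooreEval, mooreMul, sub_mul, Finset.sum_sub_distrib]
  rw [Finset.mul_sum, Finset.mul_sum]
  congr 1
  · rw [Finset.sum_range_succ']
    simp only [Nat.add_sub_cancel, Nat.add_eq_zero_iff, one_ne_zero, and_false, if_false, if_true,
      zero_mul, add_zero]
    refine Finset.sum_congr rfl fun s _ => ?_
    have he : ∑ e ∈ Finset.range (s + 1), q ^ e = (∑ e ∈ Finset.range s, q ^ e) * q + 1 := by
      rw [Finset.sum_range_succ', Finset.sum_mul, pow_zero]
      simp only [pow_succ]
    rw [he, pow_succ a, pow_mul, pow_succ q, pow_mul]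
    ring
  · exact Finset.sum_congr rfl fun s _ => by ring

theorem mooreMul_ne_zero {F : Type*} [Field F] {q k : ℕ} (b : F) {f : ℕ → F}
    (hf0 : f ≠ 0) (hf : ∀ s, k ≤ s → f s = 0) : mooreMul q b f ≠ 0 := by
  intro h
  have hstep : ∀ s, f (s + 1) = 0 → f s = 0 := fun s hs => by
    have := congrFun h (s + 1)
    simp only [mooreMul, hs, Nat.add_sub_cancel, Nat.add_eq_zero_iff, one_ne_zero, and_false,
      if_false, mul_zero, sub_zero, Pi.zero_apply] at this
    exact eq_zero_of_pow_eq_zero this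
  have hall : ∀ d s, k ≤ s + d → f s = 0 := fun d => by
    induction d with
    | zero => exact fun s hs => hf s hs
    | succ d ih => exact fun s hs => hstep s (ih (s + 1) (by omega))
  exact hf0 (funext fun s => hall k s (by omega))

theorem mooreMul_apply_eq_zero {F : Type*} [Field F] {q k : ℕ} (hq : q ≠ 0) (b : F) {f : ℕ → F}
    (hf : ∀ s, k ≤ s → f s = 0) {s : ℕ} (hs : k + 1 ≤ s) : mooreMul q b f s = 0 := by
  simp [mooreMul, hf s (by omega), hf (s - 1) (by omega), hq]

/-- The nonzero operators of degree less than `d` have codewords of weight at least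
`n - d + 1`. -/
def MooreWeightBound {F : Type*} [Field F] (Fq : Subfield F) {l μ r : ℕ}
    (a : Fin l → F) (β : Fin μ → Fin r → F) (k d : ℕ) : Prop :=
  ∀ f : ℕ → F, f ≠ 0 → (∀ s, d ≤ s → f s = 0) →
    l * μ * r + 1 ≤ srWt Fq (fun i j u => mooreEval (Nat.card Fq) k f (a i) (β j u)) + d

theorem MooreWeightBound.pred {F : Type*} [Field F] [Finite F] {Fq : Subfield F} {l μ r : ℕ}
    {a : Fin l → F} {β : Fin μ → Fin r → F} {k d : ℕ} (hdk : d ≤ k) (hdn : d + 1 ≤ l * μ * r)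
    (h : MooreWeightBound Fq a β (k + 1) (d + 1)) : MooreWeightBound Fq a β (k + 1) d := by
  intro f hf0 hf
  have hmul : ∀ b : F, l * μ * r + 1 ≤ srWt Fq (fun i j u => twistedFrobenius Fq (a i) b
      (mooreEval (Nat.card Fq) (k + 1) f (a i) (β j u))) + (d + 1) := fun b => by
    have := h (mooreMul (Nat.card Fq) b f) (mooreMul_ne_zero b hf0 hf)
      (fun s hs => mooreMul_apply_eq_zero Nat.card_pos.ne' b hf hs)
    simpa only [mooreEval_mooreMul Fq (hf k hdk)] using this
  by_cases hz : ∀ i j u, mooreEval (Nat.card Fq) (k + 1) f (a i) (β j u) = 0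
  · have := hmul 0
    simp only [hz, map_zero] at this
    have h0 := srWt_zero Fq (l := l) (μ := μ) (r := r)
    change srWt Fq (fun _ _ _ => 0) = 0 at h0
    omega
  · push Not at hz
    obtain ⟨i, j, u, hu⟩ := hz
    set w := mooreEval (Nat.card Fq) (k + 1) f (a i) (β j u) with hw
    have hlt := srWt_comp_lt Fq (fun i' => twistedFrobenius Fq (a i') (a i * w ^ Nat.card Fq / w))
      (fun i j u => mooreEval (Nat.card Fq) (k + 1) f (a i) (β j u)) hu (by
        rw [twistedFrobenius_apply]; field_simp; ring)
    have := hmul (a i * w ^ Nat.card Fq / w)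
    omega

theorem MooreWeightBound.shift {F : Type*} [Field F] [Finite F] {Fq : Subfield F} {l μ r : ℕ}
    {a : Fin l → F} {β : Fin μ → Fin r → F} {k d : ℕ} (ha : ∀ i, a i ≠ 0) (hdk : d ≤ k)
    (h : MooreWeightBound Fq a β (k + 1) d) {f : ℕ → F} (hf0 : f ≠ 0) (hf00 : f 0 = 0)
    (hf : ∀ s, d + 1 ≤ s → f s = 0) :
    l * μ * r + 1 ≤
      srWt Fq (fun i j u => mooreEval (Nat.card Fq) (k + 1) f (a i) (β j u)) + d := by
  have hroot : ∀ y : F, ∃ x, x ^ Nat.card Fq = y := fun y => by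
    obtain ⟨x, hx⟩ := Finite.surjective_of_injective
      (twistedFrobenius_zero_injective Fq (one_ne_zero (α := F))) y
    exact ⟨x, by simpa [twistedFrobenius_apply] using hx⟩
  choose g hg using fun s => hroot (f (s + 1))
  have hfg : mooreMul (Nat.card Fq) 0 g = f := by
    funext s
    cases s with
    | zero => simp [mooreMul, hf00]
    | succ s => simp [mooreMul, hg]
  have hg0 : ∀ s, d ≤ s → g s = 0 := fun s hs =>
    eq_zero_of_pow_eq_zero ((hg s).trans (hf _ (by omega)))
  have hgne : g ≠ 0 := by
    rintro rfl
    apply hf0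
    rw [← hfg]
    funext s
    simp [mooreMul, Nat.card_pos.ne']
  have hwt := h g hgne hg0
  rw [← srWt_comp_of_injective Fq (fun i => twistedFrobenius Fq (a i) 0)
    (fun i => twistedFrobenius_zero_injective Fq (ha i))] at hwt
  simpa only [← mooreEval_mooreMul Fq (hg0 k hdk), hfg] using hwt

/-- The Moore code meets the weight bound if and only if its double extension does. -/
theorem mooreWeightBound_iff_extended {F : Type*} [Field F] [Finite F] [DecidableEq F]
    {Fq : Subfield F} {l μ r : ℕ} {a : Fin l → F} {β : Fin μ → Fin r → F} {k : ℕ}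
    (ha : ∀ i, a i ≠ 0) (hk : 1 ≤ k) (hkn : k + 1 ≤ l * μ * r) :
    MooreWeightBound Fq a β (k + 1) (k + 1) ↔
    ∀ f : ℕ → F, f ≠ 0 → (∀ s, k + 1 ≤ s → f s = 0) → l * μ * r + 3 ≤
      srWt Fq (fun i j u => mooreEval (Nat.card Fq) (k + 1) f (a i) (β j u)) +
        ((if f 0 ≠ 0 then 1 else 0) + (if f k ≠ 0 then 1 else 0)) + (k + 1) := by
  constructor
  · intro h f hf0 hf
    obtain ⟨d, rfl⟩ : ∃ d, k = d + 1 := ⟨k - 1, by omega⟩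
    have h₁ := h.pred le_rfl hkn
    have h₂ := h₁.pred (Nat.le_succ d) (by omega)
    have htop : f (d + 1) = 0 → ∀ s, d + 1 ≤ s → f s = 0 := fun h0 s hs => by
      rcases hs.eq_or_lt with rfl | hs
      · exact h0
      · exact hf s hs
    by_cases hz : f 0 = 0 <;> by_cases ht : f (d + 1) = 0 <;>
      simp only [hz, ht, ne_eq, not_true_eq_false, not_false_eq_true, if_true, if_false]
    · have : _ ≤ srWt Fq (fun i j u => mooreEval (Nat.card Fq) (d + 1 + 1) f (a i) (β j u)) + d :=
        h₂.shift ha (Nat.le_succ d) hf0 hz (htop ht)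
      omega
    · have := h₁.shift ha le_rfl hf0 hz hf
      omega
    · have := h₁ f hf0 (htop ht)
      omega
    · have := h f hf0 hf
      omega
  · intro h f hf0 hf
    have := h f hf0 hf
    split_ifs at this <;> omega

theorem forall_fin_coeff_iff {F : Type*} [Field F] {k : ℕ} (P : (ℕ → F) → Prop)
    (Q : (Fin k → F) → Prop) (hPQ : ∀ f : ℕ → F, P f ↔ Q (fun s => f s)) :
    (∀ f : Fin k → F, f ≠ 0 → Q f) ↔ ∀ f : ℕ → F, f ≠ 0 → (∀ s, k ≤ s → f s = 0) → P f := by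
  constructor
  · intro h f hf0 hf
    refine (hPQ f).2 (h _ fun h0 => hf0 (funext fun s => ?_))
    by_cases hs : s < k
    · exact congrFun h0 ⟨s, hs⟩
    · exact hf s (by omega)
  · intro h f hf0
    set g : ℕ → F := fun s => if hs : s < k then f ⟨s, hs⟩ else 0 with hg
    have hgf : (fun s : Fin k => g s) = f := by
      funext s
      simp [hg]
    rw [← hgf, ← hPQ]
    refine h g ?_ fun s hs => by simp [hg, hs]
    intro h0
    apply hf0
    rw [← hgf, h0]
    rfl

/-- **Corollary (doubly extended MSRD codes).**  Let `g = ℓμ`, `n = gr`, let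
`a : Fin ℓ → F_{q^m}` have nonzero entries with pairwise distinct norms and let
`β : [μ] × [r] → F_{q^m}`.  For `2 ≤ k ≤ n`, the code `C_k(a, β)` generated by the extended
Moore matrix `M_k(a, β)` is MSRD over `F_q` for the length partition `(g, r)` if and only if
the doubly extended code `C^e_k(a, β) ⊆ F_{q^m}^{n+2}`, generated by `M_k(a, β)` with two
appended columns `(1,0,...,0)ᵀ` and `(0,...,0,1)ᵀ`, attains the Singleton bound
`d_e(C^e_k(a, β)) = (n+2) - k + 1` for the extended sum-rank metric
`d_e = d_SR + d_H` (Hamming on the two extra coordinates). -/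
theorem moore_code_MSRD_iff_doubly_extended_MSRD
    {q m l μ r : ℕ} (hl : 1 ≤ l) (hμ : 1 ≤ μ) (hr : 1 ≤ r)
    {F : Type*} [Field F] [Finite F] [DecidableEq F]
    (Fq : Subfield F) (hq : Nat.card Fq = q) (hF : Nat.card F = q ^ m)
    (a : Fin l → F) (ha0 : ∀ i, a i ≠ 0)
    (haN : ∀ i j, i ≠ j → fieldNorm q m (a i) ≠ fieldNorm q m (a j))
    (β : Fin μ → Fin r → F)
    (k : ℕ) (hk2 : 2 ≤ k) (hkn : k ≤ l * μ * r)
    (Ck : Submodule F (Fin l → Fin μ → Fin r → F))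
    (hCk : Ck = Submodule.span F (Set.range (fun s : Fin k =>
      fun (i : Fin l) (j : Fin μ) (u : Fin r) =>
        β j u ^ q ^ (s : ℕ) * a i ^ (∑ e ∈ Finset.range (s : ℕ), q ^ e))))
    (Cek : Submodule F ((Fin l → Fin μ → Fin r → F) × (Fin 2 → F)))
    (hCek : Cek = Submodule.span F (Set.range (fun s : Fin k =>
      ((fun (i : Fin l) (j : Fin μ) (u : Fin r) =>
          β j u ^ q ^ (s : ℕ) * a i ^ (∑ e ∈ Finset.range (s : ℕ), q ^ e)),
       (fun v : Fin 2 => if v = 0 then (if (s : ℕ) = 0 then 1 else 0)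
          else (if (s : ℕ) = k - 1 then 1 else 0)))))) :
    (Module.finrank F Ck = k ∧
        minDist (fun c c' : Fin l → Fin μ → Fin r → F => srWt Fq (c - c')) (Ck : Set _)
          = l * μ * r - k + 1)
    ↔ (Module.finrank F Cek = k ∧
        minDist (fun c c' : (Fin l → Fin μ → Fin r → F) × (Fin 2 → F) =>
            srWt Fq (c.1 - c'.1) + hammingDist c.2 c'.2) (Cek : Set _)
          = (l * μ * r + 2) - k + 1) := by
  subst hq hCk hCek
  obtain ⟨K, rfl⟩ : ∃ K, k = K + 1 := ⟨k - 1, by omega⟩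
  set q := Nat.card Fq with hq
  set v : Fin (K + 1) → Fin l → Fin μ → Fin r → F := fun s i j u =>
    β j u ^ q ^ (s : ℕ) * a i ^ (∑ e ∈ Finset.range (s : ℕ), q ^ e) with hv
  set y : Fin (K + 1) → Fin 2 → F := fun s t => if t = 0 then (if (s : ℕ) = 0 then 1 else 0)
    else (if (s : ℕ) = K + 1 - 1 then 1 else 0) with hy
  have hdist : (fun c c' : (Fin l → Fin μ → Fin r → F) × (Fin 2 → F) =>
      srWt Fq (c.1 - c'.1) + hammingDist c.2 c'.2) =
      fun c c' => (fun x : (Fin l → Fin μ → Fin r → F) × (Fin 2 → F) =>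
        srWt Fq x.1 + hammingNorm x.2) (c - c') := by
    funext c c'
    rw [hammingDist_comm, hammingDist_eq_hammingNorm, neg_add_eq_sub]
    rfl
  have hfst : ∀ f : Fin (K + 1) → F, (∑ s, f s • (v s, y s)).1 = ∑ s, f s • v s := fun f => by
    simp [Prod.fst_sum]
  have hsnd : ∀ f : Fin (K + 1) → F, (∑ s, f s • (v s, y s)).2 = ∑ s, f s • y s := fun f => by
    simp [Prod.snd_sum]
  obtain ⟨f₀, hf₀, hle⟩ := exists_srWt_le Fq (by omega) hkn v
  have hnorm : ∀ x : Fin 2 → F,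
      hammingNorm x = (if x 0 ≠ 0 then 1 else 0) + (if x 1 ≠ 0 then 1 else 0) := fun x => by
    rw [hammingNorm, Finset.card_filter, Fin.sum_univ_two]
  have hnorm_le : ∀ x : Fin 2 → F, hammingNorm x ≤ 2 := fun x => by
    simpa using hammingNorm_le_card_fintype (x := x)
  have hiff := finrank_and_minDist_iff (D := l * μ * r + 2 - (K + 1) + 1)
    (fun s => (v s, y s)) (fun x => srWt Fq x.1 + hammingNorm x.2)
    (by simp [srWt_zero]) (by omega) ⟨f₀, hf₀, by
      have := hnorm_le (∑ s, f₀ s • (v s, y s)).2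
      rw [← hfst] at hle
      omega⟩
  rw [hdist]
  refine (finrank_and_minDist_iff v (srWt Fq) (srWt_zero Fq) (by omega) ⟨f₀, hf₀, hle⟩).trans
    (Iff.trans ?_ hiff.symm)
  have heval : ∀ f : ℕ → F, (∑ s : Fin (K + 1), f s • v s) =
      fun i j u => mooreEval q (K + 1) f (a i) (β j u) := fun f => by
    funext i j u
    simp [mooreEval, hv, Finset.sum_apply, Finset.sum_range]
  have hcoord : ∀ f : ℕ → F, hammingNorm (∑ s : Fin (K + 1), f s • y s) =
      (if f 0 ≠ 0 then 1 else 0) + (if f K ≠ 0 then 1 else 0) := fun f => by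
    have h0 : (∑ s : Fin (K + 1), f s • y s) 0 = f 0 := by
      simp only [hy, Finset.sum_apply, Pi.smul_apply, smul_eq_mul, if_true]
      rw [← Finset.sum_range (fun s => f s * if s = 0 then (1 : F) else 0)]
      simp
    have h1 : (∑ s : Fin (K + 1), f s • y s) 1 = f K := by
      simp only [hy, Finset.sum_apply, Pi.smul_apply, smul_eq_mul, one_ne_zero, if_false,
        Nat.add_sub_cancel]
      rw [← Finset.sum_range (fun s => f s * if s = K then (1 : F) else 0)]
      simp
    rw [hnorm, h0, h1]
  rw [forall_fin_coeff_iff (fun f => l * μ * r + 1 ≤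
      srWt Fq (fun i j u => mooreEval q (K + 1) f (a i) (β j u)) + (K + 1)) _ fun f => by
      rw [heval]; omega,
    forall_fin_coeff_iff (fun f => l * μ * r + 3 ≤
      srWt Fq (fun i j u => mooreEval q (K + 1) f (a i) (β j u)) +
        ((if f 0 ≠ 0 then 1 else 0) + (if f K ≠ 0 then 1 else 0)) + (K + 1)) _ fun f => by
      rw [hfst, hsnd, heval, hcoord]; omega]
  exact mooreWeightBound_iff_extended ha0 (by omega) hkn
end

section
/- Let m be odd, q even, and set n = (q−1)μr for positive integers μ and r. Let β = (β_1,...,β_{μr}) in F_{q^m}^{μr} be such that the subspaces H_i = ⟨β_{(i−1)r+1},...,β_{ir}⟩_{F_q} satisfy dim_{F_q}(H_i) = r for all i in [μ], and H_i ∩ (Σ_{j∈Γ} H_j) = {0} for every i in [μ] and every Γ ⊆ [μ] with i ∉ Γ and |Γ| ≤ min{3,μ}−1. Let a_1,...,a_{q−1} in F_{q^m}^* with N_{F_{q^m}/F_q}(a_i) ≠ N_{F_{q^m}/F_q}(a_j) for i ≠ j. Then the triply extended 3-dimensional code C_e ⊆ F_{q^m}^{n+3} generated by the three rows whose (i,u)-block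 entries are β_u, a_i β_u^q, a_i^{q+1} β_u^{q^2} respectively (for i in [q−1], u in [μr]), appended with the identity columns (1,0,0)ᵀ, (0,1,0)ᵀ, (0,0,1)ᵀ, is MSRD for the extended sum-rank metric d_e((c,c'),(d,d')) = d_SR(c,d) + d_H(c',d'), i.e., d_e(C_e) = (n+3) − 3 + 1 = n + 1. -/
open Module in
/-- Rank-nullity for the restriction of a linear map to a submodule. -/
theorem Submodule.finrank_map_add_finrank_ker_inf {K V W : Type*} [DivisionRing K]
    [AddCommGroup V] [Module K V] [AddCommGroup W] [Module K W] [FiniteDimensional K V]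
    (f : V →ₗ[K] W) (p : Submodule K V) :
    finrank K (p.map f) + finrank K (LinearMap.ker f ⊓ p : Submodule K V) = finrank K p := by
  have h := (f.domRestrict p).finrank_range_add_finrank_ker
  rw [LinearMap.range_domRestrict, LinearMap.ker_domRestrict] at h
  rw [← h, ← Submodule.finrank_map_subtype_eq p ((LinearMap.ker f).comap p.subtype),
    Submodule.map_comap_subtype, inf_comm]

open Module in
/-- The dimension of a kernel is subadditive under composition. -/
theorem Submodule.finrank_le_ker_add_ker {K V W X : Type*} [DivisionRing K]
    [AddCommGroup V] [Module K V] [AddCommGroup W] [Module K W] [AddCommGroup X] [Module K X]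
    [FiniteDimensional K V] [FiniteDimensional K W] (f : V →ₗ[K] W) (g : W →ₗ[K] X)
    (p : Submodule K V) (hp : ∀ x ∈ p, g (f x) = 0) :
    finrank K p ≤ finrank K (LinearMap.ker f) + finrank K (LinearMap.ker g) := by
  rw [← Submodule.finrank_map_add_finrank_ker_inf f p, add_comm]
  refine add_le_add (Submodule.finrank_mono inf_le_left) (Submodule.finrank_mono ?_)
  rintro _ ⟨x, hx, rfl⟩
  exact hp x hx

open Module in
/-- If every `t` of the subspaces `H j` are independent, a subspace of dimension less than `t`
meets the `H j` in subspaces of total dimension at most its own dimension. -/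
theorem Submodule.sum_finrank_inf_le {K V ι : Type*} [DivisionRing K] [AddCommGroup V]
    [Module K V] [FiniteDimensional K V] [Fintype ι] [DecidableEq ι] (t : ℕ)
    (H : ι → Submodule K V)
    (hH : ∀ (i : ι) (Γ : Finset ι), i ∉ Γ → Γ.card ≤ min t (Fintype.card ι) - 1 →
      H i ⊓ Γ.sup H = ⊥)
    (W : Submodule K V) (hW : finrank K W < t) :
    ∑ j, finrank K (W ⊓ H j : Submodule K V) ≤ finrank K W := by
  classical
  have key : ∀ T : Finset ι, T.card ≤ t →
      ∑ j ∈ T, finrank K (W ⊓ H j : Submodule K V) =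
        finrank K (T.sup fun j => W ⊓ H j : Submodule K V) := by
    intro T
    induction T using Finset.induction_on with
    | empty => intro _; rw [Finset.sum_empty, Finset.sup_empty, finrank_bot]
    | insert i T hi ih =>
      intro hT
      have hcard : (insert i T).card ≤ Fintype.card ι := Finset.card_le_univ _
      rw [Finset.card_insert_of_notMem hi] at hT hcard
      have hdisj : W ⊓ H i ⊓ T.sup (fun j => W ⊓ H j) = ⊥ := by
        rw [eq_bot_iff, ← hH i T hi (by omega)]
        exact inf_le_inf inf_le_right (Finset.sup_mono_fun fun _ _ => inf_le_right)
      have h := Submodule.finrank_sup_add_finrank_inf_eq (W ⊓ H i) (T.sup fun j => W ⊓ H j)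
      rw [hdisj, finrank_bot, add_zero] at h
      rw [Finset.sum_insert hi, Finset.sup_insert, h, ih (by omega)]
  have key' : ∀ T : Finset ι, T.card ≤ t →
      ∑ j ∈ T, finrank K (W ⊓ H j : Submodule K V) ≤ finrank K W := fun T hT => by
    rw [key T hT]
    exact Submodule.finrank_mono (Finset.sup_le fun _ _ => inf_le_left)
  let S : Finset ι := Finset.univ.filter fun j => finrank K (W ⊓ H j : Submodule K V) ≠ 0
  rcases le_or_gt S.card t with hS | hS
  · rw [← Finset.sum_filter_ne_zero]
    exact key' S hS
  · obtain ⟨T, hTS, hT⟩ := Finset.exists_subset_card_eq hS.le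
    have h := key' T hT.le
    have h1 : T.card • 1 ≤ ∑ j ∈ T, finrank K (W ⊓ H j : Submodule K V) :=
      Finset.card_nsmul_le_sum _ _ _ fun j hj =>
        Nat.one_le_iff_ne_zero.2 (Finset.mem_filter.1 (hTS hj)).2
    simp only [smul_eq_mul, mul_one] at h1
    omega

open Module in
/-- If any two nonzero vectors of a family of subspaces are proportional and lie in the same
subspace, the total dimension of the family is at most one. -/
theorem Submodule.sum_finrank_le_one {K V ι : Type*} [DivisionRing K] [AddCommGroup V]
    [Module K V] [Fintype ι] (W : ι → Submodule K V)
    (h : ∀ i j, ∀ x ∈ W i, ∀ y ∈ W j, x ≠ 0 → y ≠ 0 → i = j ∧ ∃ t : K, t • x = y) :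
    ∑ i, finrank K (W i) ≤ 1 := by
  classical
  by_cases h0 : ∀ i, W i = ⊥
  · exact (Finset.sum_eq_zero fun i _ => by rw [h0 i, finrank_bot]).trans_le zero_le_one
  push Not at h0
  obtain ⟨i, hi⟩ := h0
  obtain ⟨x, hx, hx0⟩ := Submodule.exists_mem_ne_zero_of_ne_bot hi
  rw [Finset.sum_eq_single i]
  · refine finrank_le_one (⟨x, hx⟩ : W i) fun ⟨y, hy⟩ => ?_
    rcases eq_or_ne y 0 with rfl | hy0
    · exact ⟨0, by ext; simp⟩
    · obtain ⟨t, ht⟩ := (h i i x hx y hy hx0 hy0).2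
      exact ⟨t, Subtype.ext ht⟩
  · intro j _ hji
    rw [(Submodule.eq_bot_iff (W j)).2, finrank_bot]
    intro y hy
    by_contra hy0
    exact hji (h i j x hx y hy hx0 hy0).1.symm
  · simp

/-- The elements of a finite subfield of order `q` are the roots of `X ^ q - X`. -/
theorem Subfield.mem_iff_pow_natCard_eq {F : Type*} [Field F] (K : Subfield F) [Finite K] (x : F) :
    x ∈ K ↔ x ^ Nat.card K = x := by
  classical
  have := Fintype.ofFinite K
  have hcard : Nat.card K = Fintype.card K := Nat.card_eq_fintype_card
  constructor
  · intro hx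
    have h := FiniteField.pow_card (⟨x, hx⟩ : K)
    rw [hcard]
    exact congrArg Subtype.val h
  · intro hx
    by_contra hxK
    have h1 : 1 < Nat.card K := Finite.one_lt_card
    have hp := FiniteField.X_pow_card_sub_X_ne_zero F h1
    have hle := Polynomial.card_le_degree_of_subset_roots
      (p := (Polynomial.X ^ Nat.card K - Polynomial.X : Polynomial F))
      (Z := insert x (Finset.univ.image ((↑) : K → F))) (by
        intro y hy
        rw [Finset.insert_val_of_notMem (by simpa using hxK)] at hy
        rw [Polynomial.mem_roots', Polynomial.IsRoot]
        refine ⟨hp, ?_⟩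
        simp only [Polynomial.eval_sub, Polynomial.eval_pow, Polynomial.eval_X, sub_eq_zero]
        rcases Multiset.mem_cons.1 hy with rfl | hy
        · exact hx
        · obtain ⟨z, -, rfl⟩ := Finset.mem_image.1 (Finset.mem_def.2 hy)
          rw [hcard]
          exact congrArg Subtype.val (FiniteField.pow_card z))
    rw [FiniteField.X_pow_card_sub_X_natDegree_eq F h1,
      Finset.card_insert_of_notMem (by simpa using hxK),
      Finset.card_image_of_injective _ Subtype.val_injective, Finset.card_univ, hcard] at hle
    omega

section fieldNorm

variable {F : Type*} [Field F] (q m : ℕ)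

theorem fieldNorm_mul (x y : F) :
    fieldNorm q m (x * y) = fieldNorm q m x * fieldNorm q m y := by
  simp only [fieldNorm, mul_pow, Finset.prod_mul_distrib]

theorem fieldNorm_pow (x : F) (n : ℕ) : fieldNorm q m (x ^ n) = fieldNorm q m x ^ n := by
  simp only [fieldNorm, pow_right_comm x n, Finset.prod_pow]

theorem fieldNorm_ne_zero {x : F} (hx : x ≠ 0) : fieldNorm q m x ≠ 0 :=
  Finset.prod_ne_zero_iff.2 fun _ _ => pow_ne_zero _ hx

variable {q m}

/-- The norm is invariant under the Frobenius. -/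
theorem fieldNorm_pow_self {x : F} (hx : x ≠ 0) (hxm : x ^ q ^ m = x) :
    fieldNorm q m (x ^ q) = fieldNorm q m x := by
  have h : fieldNorm q m x * x ^ q ^ m = fieldNorm q m (x ^ q) * x := by
    have h1 := Finset.prod_range_succ (fun i => x ^ q ^ i) m
    rw [Finset.prod_range_succ'] at h1
    simpa [fieldNorm, ← pow_mul, ← pow_succ'] using h1.symm
  rw [hxm] at h
  exact (mul_right_cancel₀ hx h).symm

theorem fieldNorm_eq_of_mul_pow_eq {a c x : F} (hx : x ≠ 0) (hxm : x ^ q ^ m = x)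
    (h : a * x ^ q = c * x) : fieldNorm q m a = fieldNorm q m c := by
  have h1 := congrArg (fieldNorm q m) h
  rw [fieldNorm_mul, fieldNorm_mul, fieldNorm_pow_self hx hxm] at h1
  exact mul_right_cancel₀ (fieldNorm_ne_zero q m hx) h1

theorem fieldNorm_sq_eq_of_mul_pow_eq {a c x : F} (ha : a ≠ 0) (ham : a ^ q ^ m = a)
    (hx : x ≠ 0) (hxm : x ^ q ^ m = x) (h : a ^ (q + 1) * x ^ q ^ 2 = c * x) :
    fieldNorm q m a ^ 2 = fieldNorm q m c := by
  have h1 := congrArg (fieldNorm q m) h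
  have hxq : (x ^ q) ^ q ^ m = x ^ q := by rw [pow_right_comm, hxm]
  rw [fieldNorm_mul, fieldNorm_mul, pow_succ a, fieldNorm_mul, fieldNorm_pow_self ha ham, sq q,
    pow_mul, fieldNorm_pow_self (pow_ne_zero _ hx) hxq, fieldNorm_pow_self hx hxm, ← sq] at h1
  exact mul_right_cancel₀ (fieldNorm_ne_zero q m hx) h1

end fieldNorm

section linPoly

variable {F : Type*} [Field F] [Finite F] (Fq : Subfield F)

/-- The Frobenius `x ↦ x ^ #F_q` as an `F_q`-linear map. -/
noncomputable def qFrob : F →ₗ[Fq] F :=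
  letI := Fintype.ofFinite Fq
  (FiniteField.frobeniusAlgHom Fq F).toLinearMap

theorem qFrob_apply (x : F) : qFrob Fq x = x ^ Nat.card Fq := by
  let := Fintype.ofFinite Fq
  change x ^ Fintype.card Fq = _
  rw [Nat.card_eq_fintype_card]

/-- The linearized polynomial `c₀ x + c₁ x ^ q + c₂ x ^ (q ^ 2)`. -/
noncomputable def linPoly (c₀ c₁ c₂ : F) : F →ₗ[Fq] F :=
  LinearMap.mulLeft Fq c₀ + LinearMap.mulLeft Fq c₁ ∘ₗ qFrob Fq +
    LinearMap.mulLeft Fq c₂ ∘ₗ qFrob Fq ∘ₗ qFrob Fq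

variable {Fq} {q m : ℕ}

theorem linPoly_apply (hq : Nat.card Fq = q) (c₀ c₁ c₂ x : F) :
    linPoly Fq c₀ c₁ c₂ x = c₀ * x + c₁ * x ^ q + c₂ * x ^ q ^ 2 := by
  simp [linPoly, qFrob_apply, hq, ← pow_mul, sq q]

theorem pow_natCard_pow_eq_self (hF : Nat.card F = q ^ m) (x : F) : x ^ q ^ m = x := by
  let := Fintype.ofFinite F
  rw [← hF, Nat.card_eq_fintype_card, FiniteField.pow_card]

theorem sub_pow_natCard_subfield (hq : Nat.card Fq = q) (x y : F) :
    (x - y) ^ q = x ^ q - y ^ q := by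
  simpa only [qFrob_apply, hq] using map_sub (qFrob Fq) x y

theorem pow_natCard_subfield_injective (hq : Nat.card Fq = q) :
    Function.Injective fun x : F => x ^ q := fun x y hxy => by
  have h : (x - y) ^ q = 0 := by
    rw [sub_pow_natCard_subfield hq, sub_eq_zero]
    exact hxy
  exact sub_eq_zero.1 (eq_zero_of_pow_eq_zero h)

theorem exists_smul_eq_of_div_pow_eq (hq : Nat.card Fq = q) {x y : F} (hx : x ≠ 0)
    (h : (y / x) ^ q = y / x) : ∃ t : Fq, t • x = y :=
  ⟨⟨y / x, (Fq.mem_iff_pow_natCard_eq _).2 (hq ▸ h)⟩, div_mul_cancel₀ y hx⟩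

/-- The kernels of `f₁ * a i * x ^ q + f₂ * a i ^ (q + 1) * x ^ (q ^ 2)` are contained in those of
binomials of `q`-degree one, by extraction of a `q`-th root. -/
theorem exists_ker_linPoly_le (hq : Nat.card Fq = q)
    {ι : Type*} {a : ι → F} (ha0 : ∀ i, a i ≠ 0) {f₁ f₂ : F} (hf₂ : f₂ ≠ 0) :
    ∃ c : F, ∀ i, LinearMap.ker (linPoly Fq 0 (f₁ * a i) (f₂ * a i ^ (q + 1))) ≤
      LinearMap.ker (linPoly Fq (-c) (a i) 0) := by
  obtain ⟨c, hc⟩ := Finite.surjective_of_injective (pow_natCard_subfield_injective hq) (-f₁ / f₂)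
  dsimp only at hc
  rw [eq_div_iff hf₂] at hc
  refine ⟨c, fun i x hx => ?_⟩
  rw [LinearMap.mem_ker, linPoly_apply hq] at hx ⊢
  have h : a i * x ^ q = c * x := by
    apply pow_natCard_subfield_injective hq
    dsimp only
    refine mul_left_cancel₀ hf₂ (mul_left_cancel₀ (ha0 i) ?_)
    linear_combination hx - a i * x ^ q * hc
  linear_combination h

variable {ι : Type*} [Fintype ι] {a : ι → F}

/-- The kernels of `a i * x ^ q - c * x`, for `a i` of distinct norms, have total dimension
at most one. -/
theorem sum_finrank_ker_linPoly_neg_le_one (hq : Nat.card Fq = q) (hF : Nat.card F = q ^ m)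
    (ha0 : ∀ i, a i ≠ 0) (haN : ∀ i j, i ≠ j → fieldNorm q m (a i) ≠ fieldNorm q m (a j)) (c : F) :
    ∑ i, Module.finrank Fq (LinearMap.ker (linPoly Fq (-c) (a i) 0)) ≤ 1 := by
  have hpow : ∀ x : F, x ^ q ^ m = x := pow_natCard_pow_eq_self hF
  refine Submodule.sum_finrank_le_one _ fun i j x hx y hy hx0 hy0 => ?_
  rw [LinearMap.mem_ker, linPoly_apply hq] at hx hy
  have hx' : a i * x ^ q = c * x := by linear_combination hx
  have hy' : a j * y ^ q = c * y := by linear_combination hy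
  have hij : i = j := by
    by_contra hij
    exact haN i j hij ((fieldNorm_eq_of_mul_pow_eq hx0 (hpow x) hx').trans
      (fieldNorm_eq_of_mul_pow_eq hy0 (hpow y) hy').symm)
  refine ⟨hij, exists_smul_eq_of_div_pow_eq hq hx0 ?_⟩
  subst hij
  rw [div_pow, div_eq_div_iff (pow_ne_zero _ hx0) hx0]
  refine mul_left_cancel₀ (ha0 i) ?_
  linear_combination x * hy' - y * hx'

/-- For `m` odd and `q` even, the kernels of `a i ^ (q + 1) * x ^ (q ^ 2) - c * x`, for `a i` of
distinct norms, have total dimension at most one. -/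
theorem sum_finrank_ker_linPoly_sq_le_one (hm : Odd m) (hq2 : Even q)
    (hq : Nat.card Fq = q) (hF : Nat.card F = q ^ m)
    (ha0 : ∀ i, a i ≠ 0) (haN : ∀ i j, i ≠ j → fieldNorm q m (a i) ≠ fieldNorm q m (a j)) (c : F) :
    ∑ i, Module.finrank Fq (LinearMap.ker (linPoly Fq (-c) 0 (a i ^ (q + 1)))) ≤ 1 := by
  have hpow : ∀ x : F, x ^ q ^ m = x := pow_natCard_pow_eq_self hF
  have hchar : (2 : F) = 0 := by
    let := Fintype.ofFinite F
    have h : ringChar F = 2 := by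
      rw [FiniteField.even_card_iff_char_two, ← Nat.card_eq_fintype_card, hF, ← Nat.even_iff]
      exact hq2.pow_of_ne_zero hm.pos.ne'
    exact_mod_cast h ▸ ringChar.Nat.cast_ringChar (R := F)
  refine Submodule.sum_finrank_le_one _ fun i j x hx y hy hx0 hy0 => ?_
  rw [LinearMap.mem_ker, linPoly_apply hq] at hx hy
  have hx' : a i ^ (q + 1) * x ^ q ^ 2 = c * x := by linear_combination hx
  have hy' : a j ^ (q + 1) * y ^ q ^ 2 = c * y := by linear_combination hy
  have hij : i = j := by
    by_contra hij
    have h := (fieldNorm_sq_eq_of_mul_pow_eq (ha0 i) (hpow _) hx0 (hpow x) hx').trans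
      (fieldNorm_sq_eq_of_mul_pow_eq (ha0 j) (hpow _) hy0 (hpow y) hy').symm
    refine haN i j hij (sub_eq_zero.1 (eq_zero_of_pow_eq_zero (n := 2) ?_))
    linear_combination h +
      (fieldNorm q m (a j) ^ 2 - fieldNorm q m (a i) * fieldNorm q m (a j)) * hchar
  refine ⟨hij, exists_smul_eq_of_div_pow_eq hq hx0 ?_⟩
  subst hij
  have h2 : (y / x) ^ q ^ 2 = y / x := by
    rw [div_pow, div_eq_div_iff (pow_ne_zero _ hx0) hx0]
    refine mul_left_cancel₀ (pow_ne_zero (q + 1) (ha0 i)) ?_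
    linear_combination x * hy' - y * hx'
  obtain ⟨k, rfl⟩ := hm
  have h2k : (y / x) ^ q ^ (2 * k) = y / x := by
    clear hF haN hpow
    induction k with
    | zero => simp
    | succ k ih => rw [mul_add, pow_add, pow_mul, ih, mul_one, h2]
  have h := hpow (y / x)
  rwa [pow_succ, pow_mul, h2k] at h

/-- The kernels of the evaluation polynomials of a codeword have total dimension less than the
Hamming weight of its extension. -/
theorem sum_finrank_ker_linPoly_lt [DecidableEq F] (hm : Odd m) (hq2 : Even q)
    (hq : Nat.card Fq = q) (hF : Nat.card F = q ^ m)
    (ha0 : ∀ i, a i ≠ 0) (haN : ∀ i j, i ≠ j → fieldNorm q m (a i) ≠ fieldNorm q m (a j))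
    (f₀ f₁ f₂ : F) (hf : ![f₀, f₁, f₂] ≠ 0) :
    ∑ i, Module.finrank Fq (LinearMap.ker (linPoly Fq f₀ (f₁ * a i) (f₂ * a i ^ (q + 1)))) <
      hammingNorm ![f₀, f₁, f₂] := by
  have hnorm : hammingNorm ![f₀, f₁, f₂] =
      (if f₀ ≠ 0 then 1 else 0) + (if f₁ ≠ 0 then 1 else 0) + (if f₂ ≠ 0 then 1 else 0) := by
    simp only [hammingNorm, Finset.card_filter, Fin.sum_univ_three]
    rfl
  have hle : ∀ V W : ι → Submodule Fq F, (∀ i, V i ≤ W i) →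
      ∑ i, Module.finrank Fq (W i) ≤ 1 → ∑ i, Module.finrank Fq (V i) ≤ 1 := fun V W hVW hW =>
    (Finset.sum_le_sum fun i _ => Submodule.finrank_mono (hVW i)).trans hW
  have hinj : (∀ i x, f₀ * x + f₁ * a i * x ^ q + f₂ * a i ^ (q + 1) * x ^ q ^ 2 = 0 → x = 0) →
      ∑ i, Module.finrank Fq
        (LinearMap.ker (linPoly Fq f₀ (f₁ * a i) (f₂ * a i ^ (q + 1)))) < 1 := by
    intro h
    rw [Nat.lt_one_iff]
    refine Finset.sum_eq_zero fun i _ => ?_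
    rw [(Submodule.eq_bot_iff (LinearMap.ker _)).2, finrank_bot]
    intro x hx
    rw [LinearMap.mem_ker, linPoly_apply hq] at hx
    exact h i x hx
  have hone := sum_finrank_ker_linPoly_neg_le_one hq hF ha0 haN
  have hq0 : q ≠ 0 := hq ▸ Nat.card_pos.ne'
  rw [hnorm]
  by_cases h₀ : f₀ = 0 <;> by_cases h₁ : f₁ = 0 <;> by_cases h₂ : f₂ = 0 <;>
    simp only [h₀, h₁, h₂, ne_eq, not_true_eq_false, not_false_eq_true, if_true, if_false,
      zero_add, add_zero]
  · simp [h₀, h₁, h₂] at hf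
  · exact hinj fun i x hx => by simpa [h₀, h₁, h₂, ha0 i, hq0] using hx
  · exact hinj fun i x hx => by simpa [h₀, h₁, h₂, ha0 i, hq0] using hx
  · subst h₀
    obtain ⟨c, hc⟩ := exists_ker_linPoly_le (f₁ := f₁) hq ha0 h₂
    exact Nat.lt_succ_of_le (hle _ _ hc (hone c))
  · exact hinj fun i x hx => by simpa [h₀, h₁, h₂] using hx
  · subst h₁
    refine Nat.lt_succ_of_le (hle _ _ (fun i x hx => ?_)
      (sum_finrank_ker_linPoly_sq_le_one hm hq2 hq hF ha0 haN (-f₀ / f₂)))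
    rw [LinearMap.mem_ker, linPoly_apply hq] at hx ⊢
    field_simp
    linear_combination hx
  · subst h₂
    refine Nat.lt_succ_of_le (hle _ _ (fun i x hx => ?_) (hone (-f₀ / f₁)))
    rw [LinearMap.mem_ker, linPoly_apply hq] at hx ⊢
    field_simp
    linear_combination hx
  · by_cases hx : ∃ i, ∃ x ≠ 0, f₀ * x + f₁ * a i * x ^ q + f₂ * a i ^ (q + 1) * x ^ q ^ 2 = 0
    · obtain ⟨i₀, x₀, hx₀, h⟩ := hx
      obtain ⟨b, hb⟩ : ∃ b, b * x₀ = a i₀ * x₀ ^ q := ⟨_, div_mul_cancel₀ _ hx₀⟩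
      have hbq : b ^ q * x₀ ^ q = a i₀ ^ q * x₀ ^ q ^ 2 := by
        rw [← mul_pow, hb, mul_pow, sq q, pow_mul]
      have hroot : f₀ + (f₁ + f₂ * b ^ q) * b = 0 := by
        refine (mul_eq_zero_iff_right hx₀).1 ?_
        linear_combination h + (f₁ + f₂ * b ^ q) * hb + f₂ * a i₀ * hbq
      refine Nat.lt_succ_of_le (le_trans (Finset.sum_le_sum fun i _ => ?_)
        ((Finset.sum_add_distrib).trans_le
          (add_le_add (hone b) (hone (-(f₁ + f₂ * b ^ q) / f₂)))))
      refine Submodule.finrank_le_ker_add_ker _ _ _ fun x hx => ?_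
      rw [LinearMap.mem_ker] at hx
      rw [linPoly_apply hq] at hx ⊢
      rw [linPoly_apply hq]
      have hD : (-b * x + a i * x ^ q + 0 * x ^ q ^ 2) ^ q = a i ^ q * x ^ q ^ 2 - b ^ q * x ^ q := by
        rw [show -b * x + a i * x ^ q + 0 * x ^ q ^ 2 = a i * x ^ q - b * x by ring,
          sub_pow_natCard_subfield hq, mul_pow, mul_pow, sq q, pow_mul x]
      rw [hD]
      refine mul_left_cancel₀ h₂ ?_
      field_simp
      linear_combination hx - x * hroot
    · push Not at hx
      refine lt_trans (hinj fun i x h => ?_) (by norm_num)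
      by_contra h0
      exact hx i x h0 h

end linPoly

/-- The values of an `F_q`-linear map on a block lose exactly the dimension of the
intersection of the kernel with the span of the block. -/
theorem rkWt_map_add_finrank {F : Type*} [Field F] [Finite F] (Fq : Subfield F) {r : ℕ}
    (f : F →ₗ[Fq] F) (v : Fin r → F) :
    rkWt Fq (fun u => f (v u)) + Module.finrank Fq
      (LinearMap.ker f ⊓ Submodule.span Fq (Set.range v) : Submodule Fq F) =
      Module.finrank Fq (Submodule.span Fq (Set.range v)) := by
  rw [← Submodule.finrank_map_add_finrank_ker_inf f (Submodule.span _ _), Submodule.map_span,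
    ← Set.range_comp]
  rfl

/-- **Theorem (triply extended MSRD codes, `m` odd and `q` even).**  Let `m` be odd, `q` even,
`n = (q-1)μr`.  Let `β : [μ] × [r] → F_{q^m}` be such that the subspaces
`H i = ⟨β i 1, ..., β i r⟩_{F_q}` satisfy `dim H i = r` and
`H i ∩ (Σ_{j ∈ Γ} H j) = 0` for all `Γ ⊆ [μ]` with `i ∉ Γ` and `|Γ| ≤ min{3, μ} - 1`.
Let `a : Fin (q-1) → F_{q^m}` have nonzero entries with pairwise distinct norms.  Then the
triply extended `3`-dimensional code `C_e ⊆ F_{q^m}^{n+3}`, generated by the three rows with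
`(i, u)`-block entries `β_u`, `a_i β_u^q`, `a_i^{q+1} β_u^{q²}` and appended identity columns,
is MSRD for the extended sum-rank metric `d_e = d_SR + d_H`, i.e.
`d_e(C_e) = (n+3) - 3 + 1 = n + 1`. -/
theorem triply_extended_MSRD_of_odd_m_even_q
    {q m μ r : ℕ} (hm : Odd m) (hq2 : Even q) (hμ : 1 ≤ μ) (hr : 1 ≤ r)
    {F : Type*} [Field F] [Finite F] [DecidableEq F]
    (Fq : Subfield F) (hq : Nat.card Fq = q) (hF : Nat.card F = q ^ m)
    (β : Fin μ → Fin r → F)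
    (hdim : ∀ i : Fin μ,
      Module.finrank Fq (Submodule.span Fq (Set.range (β i))) = r)
    (hinter : ∀ (i : Fin μ) (Γ : Finset (Fin μ)), i ∉ Γ → Γ.card ≤ min 3 μ - 1 →
      Submodule.span Fq (Set.range (β i)) ⊓
        (Γ.sup fun j => Submodule.span Fq (Set.range (β j))) = ⊥)
    (a : Fin (q - 1) → F) (ha0 : ∀ i, a i ≠ 0)
    (haN : ∀ i j, i ≠ j → fieldNorm q m (a i) ≠ fieldNorm q m (a j))
    (Ce : Submodule F ((Fin (q - 1) → Fin μ → Fin r → F) × (Fin 3 → F)))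
    (hCe : Ce = Submodule.span F
      {x | x = ((fun (i : Fin (q - 1)) (j : Fin μ) (u : Fin r) => β j u),
              fun v : Fin 3 => if v = 0 then 1 else 0) ∨
           x = ((fun (i : Fin (q - 1)) (j : Fin μ) (u : Fin r) => a i * β j u ^ q),
              fun v : Fin 3 => if v = 1 then 1 else 0) ∨
           x = ((fun (i : Fin (q - 1)) (j : Fin μ) (u : Fin r) =>
                a i ^ (q + 1) * β j u ^ q ^ 2),
              fun v : Fin 3 => if v = 2 then 1 else 0)}) :
    minDist (fun c c' : (Fin (q - 1) → Fin μ → Fin r → F) × (Fin 3 → F) =>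
        srWt Fq (c.1 - c'.1) + hammingDist c.2 c'.2) (Ce : Set _)
      = (q - 1) * μ * r + 1 := by
  have hsr : ∀ f : Fin (q - 1) → F →ₗ[Fq] F,
      srWt Fq (fun i j u => f i (β j u)) + ∑ i, ∑ j, Module.finrank Fq
        (LinearMap.ker (f i) ⊓ Submodule.span Fq (Set.range (β j)) : Submodule Fq F) =
      (q - 1) * μ * r := by
    intro f
    simp only [srWt, ← Finset.sum_add_distrib, rkWt_map_add_finrank, hdim, Finset.sum_const,
      Finset.card_univ, Fintype.card_fin, smul_eq_mul, mul_assoc]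
  have hmem : ∀ x, x ∈ Ce ↔ ∃ f₀ f₁ f₂ : F,
      x = ((fun i j u => linPoly Fq f₀ (f₁ * a i) (f₂ * a i ^ (q + 1)) (β j u)),
        ![f₀, f₁, f₂]) := by
    intro x
    rw [hCe]
    refine Submodule.mem_span_triple.trans (exists₃_congr fun f₀ f₁ f₂ => ?_)
    rw [eq_comm]
    refine Eq.congr_right (Prod.ext ?_ ?_)
    · funext i j u
      simp [linPoly_apply hq, mul_assoc]
    · funext v
      fin_cases v <;> simp
  refine le_antisymm (Nat.sInf_le ⟨_, (hmem _).2 ⟨1, 0, 0, rfl⟩, 0, Ce.zero_mem, ?_, ?_⟩)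
    (le_csInf ⟨_, _, (hmem _).2 ⟨1, 0, 0, rfl⟩, 0, Ce.zero_mem, ?_, rfl⟩ ?_)
  · intro h
    simpa using congrFun (congrArg Prod.snd h) 0
  · have hrow : (fun i j u => linPoly Fq 1 (0 * a i) (0 * a i ^ (q + 1)) (β j u)) =
        fun _ j => β j := by
      funext i j u
      simp [linPoly_apply hq]
    have hsum : srWt Fq (fun (_ : Fin (q - 1)) j => β j) = (q - 1) * μ * r := by
      simp only [srWt, rkWt, hdim, Finset.sum_const, Finset.card_univ, Fintype.card_fin,
        smul_eq_mul, mul_assoc]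
    dsimp only
    rw [Prod.fst_zero, sub_zero, hrow, hsum]
    simp [hammingDist, Finset.card_filter, Fin.sum_univ_three]
  · intro h
    simpa using congrFun (congrArg Prod.snd h) 0
  · rintro _ ⟨c, hc, c', hc', hne, rfl⟩
    obtain ⟨f₀, f₁, f₂, hf⟩ := (hmem _).1 (Ce.sub_mem hc hc')
    have hdist : hammingDist c.2 c'.2 = hammingNorm ![f₀, f₁, f₂] := by
      rw [hammingDist_comm, hammingDist_eq_hammingNorm, neg_add_eq_sub]
      exact congrArg hammingNorm (congrArg Prod.snd hf)
    have hf0 : ![f₀, f₁, f₂] ≠ 0 := by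
      intro h0
      refine hne (sub_eq_zero.1 (hf.trans (Prod.ext ?_ h0)))
      have h₀ : f₀ = 0 := congrFun h0 0
      have h₁ : f₁ = 0 := congrFun h0 1
      have h₂ : f₂ = 0 := congrFun h0 2
      funext i j u
      simp [linPoly_apply hq, h₀, h₁, h₂]
    have hlt := sum_finrank_ker_linPoly_lt hm hq2 hq hF ha0 haN f₀ f₁ f₂ hf0
    have hthree : hammingNorm ![f₀, f₁, f₂] ≤ 3 := hammingNorm_le_card_fintype
    have hker : ∑ i, ∑ j, Module.finrank Fq (LinearMap.ker
          (linPoly Fq f₀ (f₁ * a i) (f₂ * a i ^ (q + 1))) ⊓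
          Submodule.span Fq (Set.range (β j)) : Submodule Fq F) ≤
        ∑ i, Module.finrank Fq
          (LinearMap.ker (linPoly Fq f₀ (f₁ * a i) (f₂ * a i ^ (q + 1)))) := by
      refine Finset.sum_le_sum fun i hi =>
        Submodule.sum_finrank_inf_le 3 _ (by simpa using hinter) _ ?_
      have := Finset.single_le_sum (f := fun i => Module.finrank Fq
        (LinearMap.ker (linPoly Fq f₀ (f₁ * a i) (f₂ * a i ^ (q + 1))))) (by simp) hi
      omega
    have h := hsr fun i => linPoly Fq f₀ (f₁ * a i) (f₂ * a i ^ (q + 1))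
    have hfst := congrArg Prod.fst hf
    dsimp only at hfst ⊢
    rw [Prod.fst_sub] at hfst
    rw [hdist, hfst]
    omega
end

section
/- Let β_1,...,β_m in F_{q^m} be F_q-linearly independent, and let a_1,...,a_{q−1} in F_{q^m}^* with N_{F_{q^m}/F_q}(a_i) ≠ N_{F_{q^m}/F_q}(a_j) for i ≠ j. Set n = (q−1)m. If m is even or q is odd, then the triply extended 3-dimensional code C_e ⊆ F_{q^m}^{n+3} generated by the three rows whose (i,u)-block entries are β_u, a_i β_u^q, a_i^{q+1} β_u^{q^2} respectively (for i in [q−1], u in [m]), appended with the identity columns (1,0,0)ᵀ, (0,1,0)ᵀ, (0,0,1)ᵀ, is NOT MSRD for the extended sum-rank metric d_e((c,c'),(d,d')) = d_SR(c,d) + d_H(c',d'), where d_SR is the sum-rank metric in F_{q^m}^n over F_q for the length partition (q−1,m); i.e., d_e(C_e) < n + 1. -/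
/-- The sum-rank weight over `F_q` for the length partition `(g, r)`, blocks indexed by
`i ∈ [g]`. -/
noncomputable def srWt1 {F : Type*} [Field F] (Fq : Subfield F) {g r : ℕ}
    (c : Fin g → Fin r → F) : ℕ :=
  ∑ i, rkWt Fq (c i)

/-- In a finite field with `q ^ m` elements there is a nontrivial `(q + 1)`-st root of unity
as soon as `m` is even or `q` is odd. -/
theorem exists_unit_ne_one_pow_succ_eq_one {q m : ℕ} (hq : 1 < q) (hmq : Even m ∨ Odd q)
    {F : Type*} [Field F] [Finite F] (hF : Nat.card F = q ^ m) (hm : m ≠ 0) :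
    ∃ ζ : Fˣ, ζ ≠ 1 ∧ ζ ^ (q + 1) = 1 := by
  obtain ⟨d, hd1, hdq, hdm⟩ : ∃ d, d ≠ 1 ∧ d ∣ q + 1 ∧ d ∣ q ^ m - 1 := by
    rcases hmq with h | h
    · refine ⟨q + 1, by lia, dvd_rfl, ?_⟩
      obtain ⟨k, rfl⟩ := h
      have h1 : q ^ 2 - 1 ∣ (q ^ 2) ^ k - 1 := by
        simpa using Nat.sub_dvd_pow_sub_pow (q ^ 2) 1 k
      rw [← two_mul, pow_mul]
      refine Dvd.dvd.trans ⟨q - 1, ?_⟩ h1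
      simpa using Nat.sq_sub_sq q 1
    · refine ⟨2, by lia, by rw [← even_iff_two_dvd]; exact h.add_one, ?_⟩
      rw [← even_iff_two_dvd]
      exact Nat.Odd.sub_odd h.pow odd_one
  have hp : Fact d.minFac.Prime := ⟨Nat.minFac_prime hd1⟩
  obtain ⟨ζ, hζ⟩ := exists_prime_orderOf_dvd_card' (G := Fˣ) d.minFac
    (by rw [Nat.card_units, hF]; exact (Nat.minFac_dvd d).trans hdm)
  refine ⟨ζ, ?_, ?_⟩
  · rintro rfl
    rw [orderOf_one] at hζ
    exact hp.out.one_lt.ne hζ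
  · exact orderOf_dvd_iff_pow_eq_one.1 (hζ ▸ (Nat.minFac_dvd d).trans hdq)

theorem minDist_le {V : Type*} (d : V → V → ℕ) {C : Set V} {c c' : V} (hc : c ∈ C)
    (hc' : c' ∈ C) (h : c ≠ c') : minDist d C ≤ d c c' :=
  Nat.sInf_le ⟨c, hc, c', hc', h, rfl⟩

theorem fieldNorm_eq_pow (q m : ℕ) {F : Type*} [Field F] (x : F) :
    fieldNorm q m x = x ^ ∑ i ∈ Finset.range m, q ^ i :=
  Finset.prod_pow_eq_pow_sum _ _ _

/-- A form of Hilbert's Theorem 90: a unit of norm one is a `(q - 1)`-st power. -/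
theorem exists_pow_pred_eq_of_fieldNorm_eq_one {q m : ℕ} (hq : 1 < q) (hm : m ≠ 0)
    {F : Type*} [Field F] [Finite F] (hF : Nat.card F = q ^ m)
    (u : Fˣ) (hu : fieldNorm q m (u : F) = 1) : ∃ b : Fˣ, b ^ (q - 1) = u := by
  obtain ⟨g, hg⟩ := IsCyclic.exists_zpow_surjective (G := Fˣ)
  obtain ⟨k, rfl⟩ := hg u
  have hgo : orderOf g = q ^ m - 1 := by
    rw [orderOf_eq_card_of_forall_mem_zpowers hg, Nat.card_units, hF]
  set N := ∑ i ∈ Finset.range m, q ^ i with hN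
  have hNq : N * (q - 1) = q ^ m - 1 := by
    have := Nat.geomSum_eq (m := q) hq m
    rw [hN, this, Nat.div_mul_cancel (by simpa using Nat.sub_dvd_pow_sub_pow q 1 m)]
  have hN0 : N ≠ 0 := by
    intro h0
    rw [h0, zero_mul] at hNq
    have := Nat.one_lt_pow hm hq
    lia
  rw [fieldNorm_eq_pow, ← Units.val_pow_eq_pow_val, Units.val_eq_one, ← hN, ← zpow_natCast,
    ← zpow_mul, ← orderOf_dvd_iff_zpow_eq_one, hgo, ← hNq] at hu
  rw [Nat.cast_mul, mul_comm k, mul_dvd_mul_iff_left (Int.natCast_ne_zero.2 hN0)] at hu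
  obtain ⟨l, rfl⟩ := hu
  refine ⟨g ^ l, ?_⟩
  rw [← zpow_natCast, ← zpow_mul, mul_comm]

/-- If `a` has nonzero entries with pairwise distinct norms, every nonzero element of `F` is of
the form `a i * b ^ (q - 1)`. -/
theorem exists_mul_pow_pred_eq {q m : ℕ} (hq : 1 < q) (hm : m ≠ 0)
    {F : Type*} [Field F] [Finite F] (hF : Nat.card F = q ^ m)
    (a : Fin (q - 1) → F) (ha0 : ∀ i, a i ≠ 0)
    (haN : ∀ i j, i ≠ j → fieldNorm q m (a i) ≠ fieldNorm q m (a j))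
    {e : F} (he : e ≠ 0) : ∃ i, ∃ b : F, b ≠ 0 ∧ a i * b ^ (q - 1) = e := by
  classical
  have := Fintype.ofFinite F
  have hroot : ∀ x : F, x ≠ 0 → fieldNorm q m x ∈ Polynomial.nthRootsFinset (q - 1) (1 : F) := by
    intro x hx
    rw [Polynomial.mem_nthRootsFinset (by lia), fieldNorm_eq_pow, ← pow_mul, Nat.geomSum_eq hq m,
      Nat.div_mul_cancel (by simpa using Nat.sub_dvd_pow_sub_pow q 1 m), ← hF,
      Nat.card_eq_fintype_card]
    exact FiniteField.pow_card_sub_one_eq_one x hx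
  obtain ⟨i, -, hi⟩ := Finset.surj_on_of_inj_on_of_card_le
    (s := (Finset.univ : Finset (Fin (q - 1)))) (fun i _ => fieldNorm q m (a i))
    (fun i _ => hroot _ (ha0 i))
    (fun i j _ _ h => by by_contra hij; exact haN i j hij h)
    (by
      rw [Finset.card_univ, Fintype.card_fin, Polynomial.nthRootsFinset]
      exact (Multiset.toFinset_card_le _).trans (Polynomial.card_nthRoots _ _)) _ (hroot e he)
  obtain ⟨b, hb⟩ := exists_pow_pred_eq_of_fieldNorm_eq_one hq hm hF
    (Units.mk0 e he / Units.mk0 (a i) (ha0 i)) (by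
      rw [fieldNorm_eq_pow] at hi ⊢
      rw [fieldNorm_eq_pow] at hi
      simp only [Units.val_div_eq_div_val, Units.val_mk0, div_pow, hi]
      exact div_self (pow_ne_zero _ (ha0 i)))
  refine ⟨i, b, b.ne_zero, ?_⟩
  rw [← Units.val_pow_eq_pow_val, hb]
  simp [mul_div_cancel₀, ha0 i]

/-- The rank weight of the image of a basis under a linear map, via rank-nullity. -/
theorem rkWt_add_finrank_ker {F : Type*} [Field F] [Finite F] (K : Subfield F) {m : ℕ}
    (hm : Module.finrank K F = m) (β : Fin m → F) (hβ : LinearIndependent K β)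
    (φ : F →ₗ[K] F) :
    rkWt K (fun u => φ (β u)) + Module.finrank K (LinearMap.ker φ) = m := by
  have hspan : Submodule.span K (Set.range β) = ⊤ :=
    hβ.span_eq_top_of_card_eq_finrank' (by simp [hm])
  have hrange : Submodule.span K (Set.range fun u => φ (β u)) = LinearMap.range φ := by
    rw [LinearMap.range_eq_map, ← hspan, Submodule.map_span, ← Set.range_comp]
    rfl
  rw [rkWt, hrange, LinearMap.finrank_range_add_finrank_ker, hm]

/-- The `K`-linear map `b ↦ x * b + z * b ^ q ^ 2`, where `q = #K`. -/
noncomputable def sqFrobMap {F : Type*} [Field F] [Finite F] (K : Subfield F) {q : ℕ}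
    (hq : Nat.card K = q) (x z : F) : F →ₗ[K] F where
  toFun b := x * b + z * b ^ q ^ 2
  map_add' b c := by
    have := Fintype.ofFinite K
    have h := map_add ((FiniteField.frobeniusAlgHom K F) ^ 2) b c
    simp only [pow_two, AlgHom.mul_apply, FiniteField.coe_frobeniusAlgHom,
      ← Nat.card_eq_fintype_card, hq, ← pow_mul] at h
    rw [pow_two, h]
    ring
  map_smul' t b := by
    have := Fintype.ofFinite K
    have h : t ^ q ^ 2 = t := by
      rw [← hq, Nat.card_eq_fintype_card, FiniteField.pow_card_pow]
    have h' : (t : F) ^ q ^ 2 = t := by exact_mod_cast congrArg Subtype.val h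
    simp only [Subfield.smul_def, smul_eq_mul, mul_pow, RingHom.id_apply, h']
    ring

/-- If `1` and `b` lie in subspaces `V i` and `V j`, and are not proportional in case `i = j`,
then the dimensions of the `V i` add up to at least two. -/
theorem two_le_sum_finrank {ι K F : Type*} [Fintype ι] [Field K] [Field F] [Algebra K F]
    [FiniteDimensional K F] (V : ι → Submodule K F) {i j : ι} {b : F} (hb : b ≠ 0)
    (hi : 1 ∈ V i) (hj : b ∈ V j) (hij : i = j → ∀ t : K, algebraMap K F t ≠ b) :
    2 ≤ ∑ k, Module.finrank K (V k) := by
  classical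
  by_cases h : i = j
  · subst h
    have hli : LinearIndependent K ![(⟨1, hi⟩ : V i), ⟨b, hj⟩] := by
      rw [LinearIndependent.pair_iff' (by simp [Subtype.ext_iff])]
      intro t ht
      refine hij rfl t ?_
      simpa [Algebra.smul_def] using congrArg Subtype.val ht
    calc 2 ≤ Module.finrank K (V i) := by simpa using hli.fintype_card_le_finrank
      _ ≤ _ := Finset.single_le_sum (f := fun k => Module.finrank K (V k))
        (fun _ _ => Nat.zero_le _) (Finset.mem_univ i)
  · have hpos : ∀ k (x : F), x ≠ 0 → x ∈ V k → 1 ≤ Module.finrank K (V k) := by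
      intro k x hx hxk
      rw [Nat.one_le_iff_ne_zero, Ne, Submodule.finrank_eq_zero]
      rintro h0
      exact hx (by simpa [h0] using hxk)
    calc 2 ≤ Module.finrank K (V i) + Module.finrank K (V j) :=
          add_le_add (hpos i 1 one_ne_zero hi) (hpos j b hb hj)
      _ = ∑ k ∈ {i, j}, Module.finrank K (V k) := by rw [Finset.sum_pair h]
      _ ≤ _ := Finset.sum_le_sum_of_subset (Finset.subset_univ _)

/-- **Proposition (triply extended linearized Reed–Solomon codes are never MSRD when `m` is
even or `q` is odd).**  Let `β 1, ..., β m ∈ F_{q^m}` be `F_q`-linearly independent, let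
`a : Fin (q-1) → F_{q^m}` have nonzero entries with pairwise distinct norms, and `n = (q-1)m`.
If `m` is even or `q` is odd, then the triply extended `3`-dimensional code
`C_e ⊆ F_{q^m}^{n+3}`, generated by the three rows with `(i, u)`-block entries `β_u`,
`a_i β_u^q`, `a_i^{q+1} β_u^{q²}` and appended identity columns, is not MSRD for the extended
sum-rank metric `d_e = d_SR + d_H` (sum-rank over `F_q` for the length partition `(q-1, m)`),
i.e. `d_e(C_e) < n + 1`. -/
theorem triply_extended_not_MSRD_of_even_m_or_odd_q
    {q m : ℕ} (hmq : Even m ∨ Odd q)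
    {F : Type*} [Field F] [Finite F] [DecidableEq F]
    (Fq : Subfield F) (hq : Nat.card Fq = q) (hF : Nat.card F = q ^ m)
    (β : Fin m → F) (hβ : LinearIndependent Fq β)
    (a : Fin (q - 1) → F) (ha0 : ∀ i, a i ≠ 0)
    (haN : ∀ i j, i ≠ j → fieldNorm q m (a i) ≠ fieldNorm q m (a j))
    (Ce : Submodule F ((Fin (q - 1) → Fin m → F) × (Fin 3 → F)))
    (hCe : Ce = Submodule.span F
      {x | x = ((fun (i : Fin (q - 1)) (u : Fin m) => β u),
              fun v : Fin 3 => if v = 0 then 1 else 0) ∨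
           x = ((fun (i : Fin (q - 1)) (u : Fin m) => a i * β u ^ q),
              fun v : Fin 3 => if v = 1 then 1 else 0) ∨
           x = ((fun (i : Fin (q - 1)) (u : Fin m) => a i ^ (q + 1) * β u ^ q ^ 2),
              fun v : Fin 3 => if v = 2 then 1 else 0)}) :
    minDist (fun c c' : (Fin (q - 1) → Fin m → F) × (Fin 3 → F) =>
        srWt1 Fq (c.1 - c'.1) + hammingDist c.2 c'.2) (Ce : Set _)
      < (q - 1) * m + 1 := by
  have : Fintype Fq := Fintype.ofFinite _
  have hq1 : 1 < q := hq ▸ Finite.one_lt_card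
  have hfr : Module.finrank Fq F = m := by
    have h := Module.natCard_eq_pow_finrank (K := Fq) (V := F)
    rw [hF, hq] at h
    exact (Nat.pow_right_injective hq1 h).symm
  have hm : m ≠ 0 := hfr ▸ Module.finrank_pos.ne'
  obtain ⟨ζ, hζ1, hζ⟩ := exists_unit_ne_one_pow_succ_eq_one hq1 hmq hF hm
  let i₀ : Fin (q - 1) := ⟨0, by lia⟩
  obtain ⟨j, b, hb0, hb⟩ := exists_mul_pow_pred_eq hq1 hm hF a ha0 haN
    (mul_ne_zero (ha0 i₀) ζ.ne_zero)
  let φ : Fin (q - 1) → F →ₗ[Fq] F := fun i =>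
    sqFrobMap Fq hq (a i₀ ^ (q + 1)) (-(a i ^ (q + 1)))
  have hker : 2 ≤ ∑ i, Module.finrank Fq (LinearMap.ker (φ i)) := by
    refine two_le_sum_finrank (fun i => LinearMap.ker (φ i)) (i := i₀) (j := j) hb0 ?_ ?_ ?_
    · simp [φ, sqFrobMap]
    · have hpow : b ^ q ^ 2 = (b ^ (q - 1)) ^ (q + 1) * b := by
        rw [← pow_mul, ← pow_succ]
        congr 1
        obtain ⟨k, rfl⟩ := Nat.exists_eq_add_of_lt hq1
        simp only [Nat.add_sub_cancel]
        ring
      have h : a j ^ (q + 1) * b ^ q ^ 2 = a i₀ ^ (q + 1) * b := by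
        have hζ' : (ζ : F) ^ (q + 1) = 1 := by simpa using congrArg Units.val hζ
        rw [hpow, ← mul_assoc, ← mul_pow, hb, mul_pow, hζ', mul_one]
      simp [φ, sqFrobMap, h]
    · rintro rfl t ht
      refine hζ1 (Units.ext ?_)
      have ht0 : t ≠ 0 := by
        rintro rfl
        exact hb0 (by simpa using ht.symm)
      have h1 : t ^ (q - 1) = 1 := by
        rw [← hq, Nat.card_eq_fintype_card]
        exact FiniteField.pow_card_sub_one_eq_one t ht0
      have h2 : b ^ (q - 1) = 1 := by
        rw [← ht, ← map_pow, h1, map_one]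
      rw [h2] at hb
      exact (mul_left_cancel₀ (ha0 i₀) hb).symm
  let w : (Fin (q - 1) → Fin m → F) × (Fin 3 → F) :=
    (fun i u => φ i (β u), ![a i₀ ^ (q + 1), 0, -1])
  have hw : w ∈ Ce := by
    have hrows : w = a i₀ ^ (q + 1) •
          ((fun _ u => β u, fun v => if v = 0 then 1 else 0) :
            (Fin (q - 1) → Fin m → F) × (Fin 3 → F)) -
        (fun i u => a i ^ (q + 1) * β u ^ q ^ 2, fun v => if v = 2 then 1 else 0) := by
      refine Prod.ext ?_ ?_
      · funext i u
        simp [w, φ, sqFrobMap, sub_eq_add_neg]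
      · funext v
        fin_cases v <;> simp [w]
    rw [hCe, hrows]
    exact Submodule.sub_mem _
      (Submodule.smul_mem _ _ (Submodule.subset_span (Or.inl rfl)))
      (Submodule.subset_span (Or.inr (Or.inr rfl)))
  have hw0 : w ≠ 0 := fun h => by
    simpa [w] using congrFun (congrArg Prod.snd h) 2
  have hsr : srWt1 Fq w.1 + 2 ≤ (q - 1) * m := by
    have h : srWt1 Fq w.1 + ∑ i, Module.finrank Fq (LinearMap.ker (φ i)) = (q - 1) * m := by
      rw [srWt1, ← Finset.sum_add_distrib,
        Finset.sum_congr rfl fun i _ => rkWt_add_finrank_ker Fq hfr β hβ (φ i)]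
      simp
    lia
  have hham : hammingDist w.2 0 ≤ 2 := by
    refine (Finset.card_le_card (t := {0, 2}) fun v hv => ?_).trans Finset.card_le_two
    fin_cases v <;> simp_all [w]
  have hmin := minDist_le (fun c c' : (Fin (q - 1) → Fin m → F) × (Fin 3 → F) =>
    srWt1 Fq (c.1 - c'.1) + hammingDist c.2 c'.2) hw Ce.zero_mem hw0
  simp only [Prod.fst_zero, Prod.snd_zero, sub_zero] at hmin
  lia
end

section
/- Let m = rρ for positive integers r and ρ. Let α_1,...,α_r in F_{q^r} be F_q-linearly independent and let γ_1,...,γ_μ in F_{q^m}^* be such that γ_i and γ_j are F_{q^r}-linearly independent whenever i ≠ j. Define β_{(j−1)r+u} = γ_j α_u for j in [μ], u in [r], and H_j = ⟨β_{(j−1)r+1},...,β_{jr}⟩_{F_q} ⊆ F_{q^m}. Then ∪_{j=1}^μ H_j = F_{q^m} if, and only if, μ = (q^m−1)/(q^r−1). -/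
open Submodule in
/-- Linearly independent vectors in a finite intermediate field, as many as its degree, span it. -/
theorem coe_span_range_eq_subfield_of_natCard {q r : ℕ} {F : Type*} [Field F] [Finite F]
    {K L : Subfield F} (hKL : K ≤ L) (hK : Nat.card K = q) (hL : Nat.card L = q ^ r)
    {α : Fin r → F} (hα : ∀ u, α u ∈ L) (hαli : LinearIndependent K α) :
    (span K (Set.range α) : Set F) = L := by
  refine Set.eq_of_subset_of_ncard_le ?_ ?_ (Set.toFinite _)
  · intro x hx
    induction hx using span_induction with
    | mem x hx => obtain ⟨u, rfl⟩ := hx; exact hα u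
    | zero => exact L.zero_mem
    | add x y _ _ hx hy => exact L.add_mem hx hy
    | smul a x _ hx => exact L.mul_mem (hKL a.2) hx
  · have h := Module.natCard_eq_pow_finrank (K := K) (V := span K (Set.range α))
    rw [finrank_span_eq_card hαli, hK, Fintype.card_fin] at h
    exact (hL.trans h.symm).le

open Submodule in
/-- Scaling a spanning family by `c` spans the scaled set. -/
theorem mem_span_range_mul_iff {ι F : Type*} [Field F] (K : Subfield F) (α : ι → F) (c x : F) :
    x ∈ span K (Set.range fun u => c * α u) ↔ ∃ a ∈ span K (Set.range α), c * a = x := by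
  have h : (Set.range fun u => c * α u) = LinearMap.mulLeft K c '' Set.range α := by
    rw [← Set.range_comp]; rfl
  rw [h, ← map_span, mem_map]
  rfl

/-- Pairwise independent vectors have disjoint punctured lines, parametrized injectively. -/
theorem injective_mul_of_pairwise_linearIndependent {ι F : Type*} [Field F] (L : Subfield F)
    (γ : ι → Fˣ) (hγ : ∀ i j, i ≠ j → LinearIndependent L ![(γ i : F), (γ j : F)]) :
    Function.Injective fun p : ι × Lˣ => γ p.1 * Units.map L.subtype.toMonoidHom p.2 := by
  rintro ⟨i, a⟩ ⟨j, b⟩ h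
  obtain rfl : i = j := by
    by_contra hij
    have h' : (γ i : F) * (a : L) = γ j * (b : L) := congrArg Units.val h
    have := LinearIndependent.pair_iff.1 (hγ i j hij) a (-b) (by
      simp only [Subfield.smul_def, smul_eq_mul, NegMemClass.coe_neg]
      linear_combination h')
    exact a.ne_zero this.1
  have h' := congrArg Units.val (mul_left_cancel h)
  exact Prod.ext rfl (Units.ext (Subtype.ext h'))

/-- **Lemma (field reduction).**  Let `m = rρ`, let `α 1, ..., α r ∈ F_{q^r}` be
`F_q`-linearly independent and `γ 1, ..., γ μ ∈ F_{q^m}^*` pairwise `F_{q^r}`-linearly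
independent.  Set `β_{(j-1)r+u} = γ_j α_u` and `H j = ⟨β_{(j-1)r+1}, ..., β_{jr}⟩_{F_q}`.
Then `⋃_j H j = F_{q^m}` if and only if `μ = (q^m - 1)/(q^r - 1)`. -/
theorem field_reduction_union_eq_univ_iff
    {q r ρ μ : ℕ} (hr : 1 ≤ r) (hρ : 1 ≤ ρ)
    {F : Type*} [Field F] [Finite F]
    (Fq Fqr : Subfield F) (hle : Fq ≤ Fqr)
    (hq : Nat.card Fq = q) (hqr : Nat.card Fqr = q ^ r) (hF : Nat.card F = q ^ (r * ρ))
    (α : Fin r → F) (hα : ∀ u, α u ∈ Fqr) (hαli : LinearIndependent Fq α)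
    (γ : Fin μ → F) (hγ0 : ∀ j, γ j ≠ 0)
    (hγli : ∀ i j, i ≠ j → LinearIndependent Fqr ![γ i, γ j]) :
    (⋃ j : Fin μ,
        (Submodule.span Fq (Set.range fun u : Fin r => γ j * α u) : Set F)) = Set.univ
      ↔ μ = (q ^ (r * ρ) - 1) / (q ^ r - 1) := by
  have hq2 : 1 < q := hq ▸ Finite.one_lt_card
  have hqr1 : 1 < q ^ r := Nat.one_lt_pow (by lia) hq2
  have hspan := coe_span_range_eq_subfield_of_natCard hle hq hqr hα hαli
  have hmem (j : Fin μ) (x : F) :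
      x ∈ Submodule.span Fq (Set.range fun u => γ j * α u) ↔ ∃ a ∈ Fqr, γ j * a = x := by
    rw [mem_span_range_mul_iff]
    simp only [← SetLike.mem_coe, hspan]
  have hinj := injective_mul_of_pairwise_linearIndependent Fqr
    (fun j => Units.mk0 (γ j) (hγ0 j)) hγli
  set f := fun p : Fin μ × Fqrˣ =>
    Units.mk0 (γ p.1) (hγ0 p.1) * Units.map Fqr.subtype.toMonoidHom p.2
  have hsurj : (⋃ j : Fin μ,
      (Submodule.span Fq (Set.range fun u : Fin r => γ j * α u) : Set F)) = Set.univ ↔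
      Function.Surjective f := by
    simp only [Set.eq_univ_iff_forall, Set.mem_iUnion, SetLike.mem_coe, hmem]
    constructor
    · intro h x
      obtain ⟨j, a, ha, hx⟩ := h x
      have ha0 : (⟨a, ha⟩ : Fqr) ≠ 0 := by
        intro h0
        have : a = 0 := congrArg Subtype.val h0
        exact x.ne_zero (by rw [← hx, this, mul_zero])
      exact ⟨(j, Units.mk0 _ ha0), Units.ext hx⟩
    · intro h x
      by_cases hx : x = 0
      · obtain ⟨⟨j, _⟩, _⟩ := h 1
        exact ⟨j, 0, Fqr.zero_mem, by rw [hx, mul_zero]⟩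
      · obtain ⟨⟨j, a⟩, ha⟩ := h (Units.mk0 x hx)
        exact ⟨j, (a : Fqr), (a : Fqr).2, congrArg Units.val ha⟩
  have hcard : Function.Surjective f ↔ μ * (q ^ r - 1) = q ^ (r * ρ) - 1 := by
    have h := Nat.bijective_iff_injective_and_card f
    rw [Nat.card_prod, Nat.card_units, Nat.card_units, hqr, hF, Nat.card_fin] at h
    exact ⟨fun hs => (h.1 ⟨hinj, hs⟩).2, fun hc => (h.2 ⟨hinj, hc⟩).2⟩
  have hdvd : q ^ r - 1 ∣ q ^ (r * ρ) - 1 := by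
    simpa [pow_mul] using Nat.sub_dvd_pow_sub_pow (q ^ r) 1 ρ
  rw [hsurj, hcard, eq_comm (a := μ), Nat.div_eq_iff_eq_mul_left (by lia) hdvd, eq_comm]
end

section
/- Let a_1,...,a_{q−1} in F_{q^m}^* with N_{F_{q^m}/F_q}(a_i) ≠ N_{F_{q^m}/F_q}(a_j) for i ≠ j, and let β = (β_1,...,β_{μr}) in F_{q^m}^{μr} with H_i = ⟨β_{(i−1)r+1},...,β_{ir}⟩_{F_q} satisfying: dim_{F_q}(H_i) = r for all i in [μ], and H_i ∩ (Σ_{j∈Γ} H_j) = {0} for every i and every Γ ⊆ [μ] with i ∉ Γ and |Γ| ≤ min{2,μ}−1. Set g = (q−1)μ, n = gr. Consider the 2-dimensional doubly extended MSRD code C_e ⊆ F_{q^m}^{n+2} generated by the two rows whose (i,u)-block entries are β_u and a_i β_u^q respectively, appended with the columns (1,0)ᵀ and (0,1)ᵀ, and the extended metric d_e((c,c_{n+1},c_{n+2}),(d,d_{n+1},d_{n+2})) = d_SR(c,d) + d_H((c_{n+1},c_{n+2}),(d_{n+1},d_{n+2})). Then C_e is a one-weight code for d_e (every nonzero codeword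 has d_e-weight n+1) if, and only if, ∪_{i=1}^μ H_i = F_{q^m}. -/
/-- In a finite cyclic group of order `d * e`, the kernel of the `e`-th power map consists of
`d`-th powers. -/
theorem IsCyclic.exists_pow_eq_of_pow_eq_one {G : Type*} [CommGroup G] [IsCyclic G] [Finite G]
    {d e : ℕ} (hG : Nat.card G = d * e) {b : G} (hb : b ^ e = 1) : ∃ t : G, t ^ d = b := by
  have hd : 0 < d := Nat.pos_of_mul_pos_right (hG ▸ Nat.card_pos)
  have hle : (powMonoidHom d : G →* G).range ≤ (powMonoidHom e : G →* G).ker := by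
    rintro _ ⟨t, rfl⟩
    simp [MonoidHom.mem_ker, ← pow_mul, ← hG]
  have heq := Subgroup.eq_of_le_of_card_ge hle (by
    rw [IsCyclic.card_powMonoidHom_range, IsCyclic.card_powMonoidHom_ker, hG,
      Nat.gcd_mul_left_left, Nat.gcd_mul_right_left, Nat.mul_div_cancel_left _ hd])
  have : b ∈ (powMonoidHom d : G →* G).range := heq ▸ hb
  exact this

/-- In a finite cyclic group of order `d * e`, a family of `d` elements with distinct `e`-th powers
represents all classes modulo `d`-th powers. -/
theorem IsCyclic.exists_pow_mul_eq {G : Type*} [CommGroup G] [IsCyclic G] [Finite G]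
    {d e : ℕ} (hG : Nat.card G = d * e) {a : Fin d → G}
    (ha : Function.Injective fun i => a i ^ e) (b : G) : ∃ i t, t ^ d * a i = b := by
  have hmem (x : G) : x ^ e ∈ (powMonoidHom d : G →* G).ker := by
    simp [MonoidHom.mem_ker, ← pow_mul, mul_comm e, ← hG]
  let f : Fin d → (powMonoidHom d : G →* G).ker := fun i => ⟨a i ^ e, hmem _⟩
  have hf : Function.Bijective f := by
    rw [Nat.bijective_iff_injective_and_card]
    refine ⟨fun i j h => ha (congrArg Subtype.val h), ?_⟩
    rw [IsCyclic.card_powMonoidHom_ker, hG, Nat.gcd_mul_right_left, Nat.card_fin]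
  obtain ⟨i, hi⟩ := hf.2 ⟨b ^ e, hmem b⟩
  have hi' : a i ^ e = b ^ e := congrArg Subtype.val hi
  obtain ⟨t, ht⟩ := exists_pow_eq_of_pow_eq_one hG (b := b / a i) (by rw [div_pow, hi', div_self'])
  exact ⟨i, t, by rw [ht, div_mul_cancel]⟩

theorem Subfield.mem_of_pow_card_eq {F : Type*} [Field F] (K : Subfield F) [Finite K] {z : F}
    (hz : z ^ Nat.card K = z) : z ∈ K := by
  have := Fintype.ofFinite K
  rw [Nat.card_eq_fintype_card] at hz
  have hsplit : (Polynomial.X ^ Fintype.card K - Polynomial.X : Polynomial K).Splits := by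
    rw [Polynomial.splits_iff_card_roots, FiniteField.roots_X_pow_card_sub_X,
      FiniteField.X_pow_card_sub_X_natDegree_eq K Fintype.one_lt_card]
    rfl
  have hmem : z ∈ ((Polynomial.X ^ Fintype.card K - Polynomial.X : Polynomial K).map
      (algebraMap K F)).roots := by
    rw [Polynomial.mem_roots (Polynomial.map_ne_zero
      (FiniteField.X_pow_card_sub_X_ne_zero K Fintype.one_lt_card))]
    simp [hz]
  rw [hsplit.roots_map, FiniteField.roots_X_pow_card_sub_X, Multiset.mem_map] at hmem
  obtain ⟨c, -, rfl⟩ := hmem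
  exact c.2

/-- The `K`-linear map `t ↦ x t + y t ^ |K|`. -/
noncomputable def frobeniusBinomial {F : Type*} [Field F] (K : Subfield F) [Finite K] (x y : F) :
    F →ₗ[K] F :=
  letI := Fintype.ofFinite K
  LinearMap.mulLeft K x + LinearMap.mulLeft K y ∘ₗ (FiniteField.frobeniusAlgHom K F).toLinearMap

theorem frobeniusBinomial_apply {F : Type*} [Field F] (K : Subfield F) [Finite K] (x y t : F) :
    frobeniusBinomial K x y t = x * t + y * t ^ Nat.card K := by
  let := Fintype.ofFinite K
  rw [Nat.card_eq_fintype_card]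
  simp [frobeniusBinomial]

theorem rkWt_comp_add_finrank_ker_inf {F : Type*} [Field F] [Finite F] (K : Subfield F) {r : ℕ}
    (L : F →ₗ[K] F) (v : Fin r → F) :
    rkWt K (fun u => L (v u)) +
      Module.finrank K (L.ker ⊓ Submodule.span K (Set.range v) : Submodule K F) = rkWt K v := by
  have hrange : Set.range (fun u => L (v u)) = L '' Set.range v := Set.range_comp L v
  rw [rkWt, rkWt, hrange, Submodule.span_image]
  set H := Submodule.span K (Set.range v)
  rw [← (L.domRestrict H).finrank_range_add_finrank_ker, LinearMap.range_domRestrict,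
    LinearMap.ker_domRestrict, inf_comm, ← Submodule.map_comap_subtype,
    (Submodule.equivMapOfInjective H.subtype H.injective_subtype _).finrank_eq]

theorem frobeniusBinomial_eq_zero_iff {F : Type*} [Field F] (K : Subfield F) [Finite K]
    {x y b t : F} (hy : y ≠ 0) (ht : t ≠ 0) :
    frobeniusBinomial K x (y * b) t = 0 ↔ t ^ (Nat.card K - 1) * b = -x / y := by
  rw [frobeniusBinomial_apply, ← mul_pow_sub_one Nat.card_pos.ne' t, eq_div_iff hy]
  have : x * t + y * b * (t * t ^ (Nat.card K - 1)) =
      t * (t ^ (Nat.card K - 1) * b * y - -x) := by ring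
  rw [this, mul_eq_zero, or_iff_right ht, sub_eq_zero]

theorem Subfield.mem_span_singleton_of_pow_eq {F : Type*} [Field F] (K : Subfield F) [Finite K]
    {s t : F} (hs : s ≠ 0) (h : s ^ (Nat.card K - 1) = t ^ (Nat.card K - 1)) :
    t ∈ Submodule.span K {s} := by
  have hz : t / s ∈ K := K.mem_of_pow_card_eq <| by
    rw [← mul_pow_sub_one Nat.card_pos.ne', div_pow, ← h, div_self (pow_ne_zero _ hs), mul_one]
  exact Submodule.mem_span_singleton.2 ⟨⟨t / s, hz⟩, div_mul_cancel₀ t hs⟩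

theorem card_sub_one_mul_geom_sum {F : Type*} [Field F] (K : Subfield F) [Finite K] {m : ℕ}
    (hF : Nat.card F = Nat.card K ^ m) :
    (Nat.card K - 1) * ∑ i ∈ Finset.range m, Nat.card K ^ i = Nat.card F - 1 := by
  rw [hF, mul_comm, geom_sum_mul_of_one_le Nat.card_pos]

/-- If `s` and `t` are nonzero and `s ^ (q - 1) a = t ^ (q - 1) b`, then `a` and `b` have the same
norm. -/
theorem fieldNorm_eq_of_pow_mul_eq {F : Type*} [Field F] [Finite F] (K : Subfield F) {m : ℕ}
    (hF : Nat.card F = Nat.card K ^ m) {s t a b : F} (hs : s ≠ 0) (ht : t ≠ 0)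
    (h : s ^ (Nat.card K - 1) * a = t ^ (Nat.card K - 1) * b) :
    fieldNorm (Nat.card K) m a = fieldNorm (Nat.card K) m b := by
  have hone {u : F} (hu : u ≠ 0) : u ^ (Nat.card F - 1) = 1 := by
    let := Fintype.ofFinite F
    rw [Nat.card_eq_fintype_card]
    exact FiniteField.pow_card_sub_one_eq_one u hu
  have hpow := congrArg (· ^ ∑ i ∈ Finset.range m, Nat.card K ^ i) h
  simpa only [fieldNorm_eq_pow, mul_pow, ← pow_mul, card_sub_one_mul_geom_sum K hF, hone hs,
    hone ht, one_mul] using hpow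

/-- Elements with pairwise distinct norms, `q - 1` in number, represent all nonzero classes modulo
`(q - 1)`-th powers. -/
theorem exists_pow_mul_eq_of_fieldNorm_ne {F : Type*} [Field F] [Finite F] (K : Subfield F) {m : ℕ}
    (hF : Nat.card F = Nat.card K ^ m) {a : Fin (Nat.card K - 1) → F} (ha0 : ∀ i, a i ≠ 0)
    (haN : ∀ i j, i ≠ j → fieldNorm (Nat.card K) m (a i) ≠ fieldNorm (Nat.card K) m (a j))
    {b : F} (hb : b ≠ 0) : ∃ i, ∃ t ≠ 0, t ^ (Nat.card K - 1) * a i = b := by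
  have hG : Nat.card Fˣ = (Nat.card K - 1) * ∑ i ∈ Finset.range m, Nat.card K ^ i := by
    rw [card_sub_one_mul_geom_sum K hF, Nat.card_units]
  obtain ⟨i, t, h⟩ := IsCyclic.exists_pow_mul_eq hG (a := fun i => Units.mk0 (a i) (ha0 i))
    (fun i j hij => by
      by_contra hne
      refine haN i j hne ?_
      simpa [fieldNorm_eq_pow] using congrArg Units.val hij) (Units.mk0 b hb)
  exact ⟨i, t, t.ne_zero, by simpa using congrArg Units.val h⟩

/-- The total dimension of the intersections of the kernels of `t ↦ x t + y aᵢ t ^ |K|` with the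
subspaces `H j`. -/
noncomputable def kernelDefect {F : Type*} [Field F] (K : Subfield F) [Finite K] {l μ : ℕ}
    (a : Fin l → F) (H : Fin μ → Submodule K F) (x y : F) : ℕ :=
  ∑ i, ∑ j, Module.finrank K ((frobeniusBinomial K x (y * a i)).ker ⊓ H j : Submodule K F)

theorem srWt_add_kernelDefect {F : Type*} [Field F] [Finite F] (K : Subfield F) {l μ r : ℕ}
    (a : Fin l → F) (β : Fin μ → Fin r → F)
    (hdim : ∀ j, Module.finrank K (Submodule.span K (Set.range (β j))) = r) (x y : F) :
    srWt K (fun i j u => x * β j u + y * (a i * β j u ^ Nat.card K)) +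
      kernelDefect K a (fun j => Submodule.span K (Set.range (β j))) x y = l * μ * r := by
  have h (i : Fin l) (j : Fin μ) := rkWt_comp_add_finrank_ker_inf K
    (frobeniusBinomial K x (y * a i)) (β j)
  have hr (j : Fin μ) : rkWt K (β j) = r := hdim j
  simp only [frobeniusBinomial_apply, hr, mul_assoc] at h
  simp [srWt, kernelDefect, ← Finset.sum_add_distrib, h, mul_assoc]

theorem kernelDefect_eq_zero {F : Type*} [Field F] (K : Subfield F) [Finite K] {l μ : ℕ}
    (a : Fin l → F) (H : Fin μ → Submodule K F) {x y : F}
    (h : ∀ i, (frobeniusBinomial K x (y * a i)).ker = ⊥) : kernelDefect K a H x y = 0 := by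
  refine Finset.sum_eq_zero fun i _ => Finset.sum_eq_zero fun j _ => ?_
  rw [h i, bot_inf_eq, finrank_bot]

theorem kernelDefect_eq_one {F : Type*} [Field F] [Finite F] (K : Subfield F) {m μ : ℕ}
    (hF : Nat.card F = Nat.card K ^ m) {a : Fin (Nat.card K - 1) → F} (ha0 : ∀ i, a i ≠ 0)
    (haN : ∀ i j, i ≠ j → fieldNorm (Nat.card K) m (a i) ≠ fieldNorm (Nat.card K) m (a j))
    {H : Fin μ → Submodule K F} (hH : Pairwise fun i j => H i ⊓ H j = ⊥)
    (hU : (⋃ j, (H j : Set F)) = Set.univ) {x y : F} (hx : x ≠ 0) (hy : y ≠ 0) :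
    kernelDefect K a H x y = 1 := by
  obtain ⟨i₀, t, ht, hti⟩ := exists_pow_mul_eq_of_fieldNorm_ne K hF ha0 haN
    (div_ne_zero (neg_ne_zero.2 hx) hy)
  obtain ⟨j₀, hj₀⟩ := Set.mem_iUnion.1 (hU ▸ Set.mem_univ t)
  have hker₀ : (frobeniusBinomial K x (y * a i₀)).ker = Submodule.span K {t} := by
    refine le_antisymm (fun s hs => ?_) ?_
    · obtain rfl | hs0 := eq_or_ne s 0
      · exact zero_mem _
      have hs' := (frobeniusBinomial_eq_zero_iff K hy hs0).1 hs
      exact K.mem_span_singleton_of_pow_eq ht (mul_right_cancel₀ (ha0 i₀) (hti.trans hs'.symm))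
    · rw [Submodule.span_singleton_le_iff_mem]
      exact (frobeniusBinomial_eq_zero_iff K hy ht).2 hti
  have hker (i) (hi : i ≠ i₀) : (frobeniusBinomial K x (y * a i)).ker = ⊥ := by
    rw [eq_bot_iff]
    intro s hs
    by_contra hs0
    have hs' := (frobeniusBinomial_eq_zero_iff K hy hs0).1 hs
    exact haN i i₀ hi (fieldNorm_eq_of_pow_mul_eq K hF hs0 ht (hs'.trans hti.symm))
  have htj : Submodule.span K {t} ≤ H j₀ := (Submodule.span_singleton_le_iff_mem _ _).2 hj₀
  rw [kernelDefect, Finset.sum_eq_single i₀, Finset.sum_eq_single j₀, hker₀,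
    inf_eq_left.2 htj, finrank_span_singleton ht]
  · intro j _ hj
    rw [hker₀, eq_bot_iff.2 ((inf_le_inf_right _ htj).trans (hH hj.symm).le), finrank_bot]
  · simp
  · intro i _ hi
    refine Finset.sum_eq_zero fun j _ => ?_
    rw [hker i hi, bot_inf_eq, finrank_bot]
  · simp

theorem mem_iUnion_of_kernelDefect_ne_zero {F : Type*} [Field F] [Finite F] (K : Subfield F)
    {m μ : ℕ} (hF : Nat.card F = Nat.card K ^ m) {a : Fin (Nat.card K - 1) → F}
    (ha0 : ∀ i, a i ≠ 0)
    (haN : ∀ i j, i ≠ j → fieldNorm (Nat.card K) m (a i) ≠ fieldNorm (Nat.card K) m (a j))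
    {H : Fin μ → Submodule K F} {t : F} (ht : t ≠ 0) (i : Fin (Nat.card K - 1))
    (h : kernelDefect K a H (-(t ^ (Nat.card K - 1) * a i)) 1 ≠ 0) :
    t ∈ ⋃ j, (H j : Set F) := by
  obtain ⟨k, -, hk⟩ := Finset.exists_ne_zero_of_sum_ne_zero h
  obtain ⟨j, -, hj⟩ := Finset.exists_ne_zero_of_sum_ne_zero hk
  have hbot : (frobeniusBinomial K (-(t ^ (Nat.card K - 1) * a i)) (1 * a k)).ker ⊓ H j ≠ ⊥ :=
    fun hbot => hj (by rw [hbot, finrank_bot])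
  obtain ⟨s, hs, hs0⟩ := Submodule.exists_mem_ne_zero_of_ne_bot hbot
  have hsk := (frobeniusBinomial_eq_zero_iff K one_ne_zero hs0).1 hs.1
  rw [neg_neg, div_one] at hsk
  obtain rfl : k = i := by
    by_contra hne
    exact haN k i hne (fieldNorm_eq_of_pow_mul_eq K hF hs0 ht hsk)
  refine Set.mem_iUnion.2 ⟨j, ?_⟩
  exact (Submodule.span_singleton_le_iff_mem _ _).2 hs.2
    (K.mem_span_singleton_of_pow_eq hs0 (mul_right_cancel₀ (ha0 k) hsk))

/-- **Proposition (one-weight doubly extended MSRD codes).**  With `a : Fin (q-1) → F_{q^m}`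
nonzero with pairwise distinct norms, `β : [μ] × [r] → F_{q^m}` such that the subspaces
`H i = ⟨β i 1, ..., β i r⟩_{F_q}` satisfy the MSRD conditions (for `k = 2`), `g = (q-1)μ` and
`n = gr`, the `2`-dimensional doubly extended MSRD code `C_e ⊆ F_{q^m}^{n+2}`, generated by
the two rows with `(i, u)`-block entries `β_u` and `a_i β_u^q` appended with the identity
columns `(1,0)ᵀ`, `(0,1)ᵀ`, is a one-weight code for the extended sum-rank metric
`d_e = d_SR + d_H` (i.e. every nonzero codeword has `d_e`-weight `n + 1`) if and only if
`⋃_i H i = F_{q^m}`. -/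
theorem doubly_extended_one_weight_iff
    {q m μ r : ℕ} (hμ : 1 ≤ μ) (hr : 1 ≤ r)
    {F : Type*} [Field F] [Finite F] [DecidableEq F]
    (Fq : Subfield F) (hq : Nat.card Fq = q) (hF : Nat.card F = q ^ m)
    (a : Fin (q - 1) → F) (ha0 : ∀ i, a i ≠ 0)
    (haN : ∀ i j, i ≠ j → fieldNorm q m (a i) ≠ fieldNorm q m (a j))
    (β : Fin μ → Fin r → F)
    (hdim : ∀ i : Fin μ,
      Module.finrank Fq (Submodule.span Fq (Set.range (β i))) = r)
    (hinter : ∀ (i : Fin μ) (Γ : Finset (Fin μ)), i ∉ Γ → Γ.card ≤ min 2 μ - 1 →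
      Submodule.span Fq (Set.range (β i)) ⊓
        (Γ.sup fun j => Submodule.span Fq (Set.range (β j))) = ⊥)
    (Ce : Submodule F ((Fin (q - 1) → Fin μ → Fin r → F) × (Fin 2 → F)))
    (hCe : Ce = Submodule.span F
      {x | x = ((fun (i : Fin (q - 1)) (j : Fin μ) (u : Fin r) => β j u), ![1, 0]) ∨
           x = ((fun (i : Fin (q - 1)) (j : Fin μ) (u : Fin r) => a i * β j u ^ q),
              ![0, 1])}) :
    (∀ c ∈ Ce, c ≠ 0 →
        srWt Fq c.1 + hammingNorm c.2 = (q - 1) * μ * r + 1)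
      ↔ (⋃ i : Fin μ, (Submodule.span Fq (Set.range (β i)) : Set F)) = Set.univ := by
  subst hq
  set H : Fin μ → Submodule Fq F := fun j => Submodule.span Fq (Set.range (β j))
  have hpair : Pairwise fun i j => H i ⊓ H j = ⊥ := fun i j hij => by
    have h2 : 2 ≤ μ := by
      have := i.2
      have := j.2
      have := Fin.val_ne_of_ne hij
      omega
    simpa using hinter i {j} (by simpa using hij) (by simp [h2])
  have hwt := srWt_add_kernelDefect Fq a β hdim
  have hCmem (c) : c ∈ Ce ↔ ∃ x y : F,
      ((fun i j u => x * β j u + y * (a i * β j u ^ Nat.card Fq)), ![x, y]) = c := by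
    have hset (A B : (Fin (Nat.card Fq - 1) → Fin μ → Fin r → F) × (Fin 2 → F)) :
        {x | x = A ∨ x = B} = {A, B} := rfl
    rw [hCe, hset, Submodule.mem_span_pair]
    refine exists₂_congr fun x y => Eq.congr_left ?_
    refine Prod.ext rfl ?_
    ext i
    fin_cases i <;> simp
  have hham (x y : F) : hammingNorm ![x, y] =
      (if x ≠ 0 then 1 else 0) + (if y ≠ 0 then 1 else 0) := by
    by_cases hx : x = 0 <;> by_cases hy : y = 0 <;>
      simp [hammingNorm, Finset.card_filter, Fin.sum_univ_two, hx, hy]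
  constructor
  · intro hone
    refine Set.eq_univ_of_forall fun t => ?_
    obtain rfl | ht := eq_or_ne t 0
    · exact Set.mem_iUnion.2 ⟨⟨0, hμ⟩, zero_mem _⟩
    let i : Fin (Nat.card Fq - 1) := ⟨0, Nat.sub_pos_of_lt Finite.one_lt_card⟩
    refine mem_iUnion_of_kernelDefect_ne_zero Fq hF ha0 haN ht i fun h0 => ?_
    have hx : -(t ^ (Nat.card Fq - 1) * a i) ≠ 0 :=
      neg_ne_zero.2 (mul_ne_zero (pow_ne_zero _ ht) (ha0 i))
    generalize -(t ^ (Nat.card Fq - 1) * a i) = x at h0 hx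
    have h1 := hone _ ((hCmem _).2 ⟨x, 1, rfl⟩) fun h =>
      hx (congrFun (congrArg Prod.snd h) 0)
    have h2 := hwt x 1
    rw [h0] at h2
    simp only [hham, hx, one_ne_zero, ne_eq, not_false_eq_true, if_true] at h1
    omega
  · intro hU c hc hc0
    obtain ⟨x, y, rfl⟩ := (hCmem c).1 hc
    have h2 := hwt x y
    simp only [hham]
    by_cases hx : x = 0
    · have hy : y ≠ 0 := by
        rintro rfl
        refine hc0 (Prod.ext ?_ ?_)
        · ext
          simp [hx]
        · ext i
          fin_cases i <;> simp [hx]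
      have h0 : kernelDefect Fq a H x y = 0 := kernelDefect_eq_zero _ _ _ fun i => by
        rw [LinearMap.ker_eq_bot']
        intro t ht
        simpa [frobeniusBinomial_apply, hx, hy, ha0 i, Nat.card_pos.ne'] using ht
      rw [h0] at h2
      simp only [hx, hy, ne_eq, not_true_eq_false, not_false_eq_true, if_true, if_false] at h2 ⊢
      omega
    by_cases hy : y = 0
    · have h0 : kernelDefect Fq a H x y = 0 := kernelDefect_eq_zero _ _ _ fun i => by
        rw [LinearMap.ker_eq_bot']
        intro t ht
        simpa [frobeniusBinomial_apply, hx, hy] using ht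
      rw [h0] at h2
      simp only [hx, hy, ne_eq, not_true_eq_false, not_false_eq_true, if_true, if_false] at h2 ⊢
      omega
    rw [kernelDefect_eq_one Fq hF ha0 haN hpair hU hx hy] at h2
    simp only [hx, hy, ne_eq, not_false_eq_true, if_true]
    omega
end

section
/- Let q = 2, let m ≥ 3 be odd, and set n = μr for positive integers μ and r. Let β = (β_1,...,β_{μr}) in F_{2^m}^{μr} with H_i = ⟨β_{(i−1)r+1},...,β_{ir}⟩_{F_2} satisfying dim_{F_2}(H_i) = r for all i in [μ] and H_i ∩ (Σ_{j∈Γ} H_j) = {0} for every i and every Γ ⊆ [μ] with i ∉ Γ and |Γ| ≤ min{3,μ}−1. Then the triply extended code C_e ⊆ F_{2^m}^{n+3} generated by the rows (β_1,...,β_{μr},1,0,0), (β_1^2,...,β_{μr}^2,0,1,0), (β_1^4,...,β_{μr}^4,0,0,1) is MSRD but NOT a one-weight code for the extended sum-rank metric d_e((c,c'),(d,d')) = d_SR(c,d) + d_H(c',d'), where d_SR is the sum-rank metric in F_{2^m}^n over F_2 for the length partition (μ,r); that is, d_e(C_e) = n+1 but some nonzero codeword of C_e has d_e-weight strictly greater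 than n+1. -/
section LinearizedQuartic

open Module

section Subspaces

variable {k V W : Type*} [Field k] [AddCommGroup V] [Module k V] [FiniteDimensional k V]
  [AddCommGroup W] [Module k W]

theorem finrank_map_add_finrank_ker_inf (L : V →ₗ[k] W) (H : Submodule k V) :
    finrank k (H.map L) + finrank k ↥(LinearMap.ker L ⊓ H) = finrank k H := by
  have h := LinearMap.finrank_range_add_finrank_ker (L.domRestrict H)
  rw [LinearMap.range_domRestrict, LinearMap.ker_domRestrict] at h
  rw [← h, LinearEquiv.finrank_eq (Submodule.equivSubtypeMap H (Submodule.comap H.subtype _)),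
    Submodule.map_comap_subtype, inf_comm]

theorem Finset.SupIndep.sum_finrank {ι : Type*} {T : Finset ι} {P : ι → Submodule k V}
    (h : T.SupIndep P) : ∑ i ∈ T, finrank k (P i) = finrank k ↥(T.sup P) := by
  classical
  induction T using Finset.induction_on with
  | empty => rw [Finset.sum_empty, Finset.sup_empty, finrank_bot]
  | insert a T ha ih =>
    rw [Finset.sum_insert ha, ih (h.subset (Finset.subset_insert _ _)), Finset.sup_insert]
    have hd : Disjoint (P a) (T.sup P) :=
      h (Finset.subset_insert _ _) (Finset.mem_insert_self _ _) ha
    have := Submodule.finrank_sup_add_finrank_inf_eq (P a) (T.sup P)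
    rw [hd.eq_bot, finrank_bot] at this
    omega

/-- If any three members of a family of subspaces are independent, then the members meet a plane
in dimensions summing to at most the dimension of that plane. -/
theorem sum_finrank_inf_le {ι : Type*} [Fintype ι] {H : ι → Submodule k V}
    (hH : ∀ T : Finset ι, T.card ≤ 3 → T.SupIndep H) (K : Submodule k V)
    (hK : finrank k K ≤ 2) : ∑ i, finrank k ↥(K ⊓ H i) ≤ finrank k K := by
  classical
  have key : ∀ T : Finset ι, T.card ≤ 3 → ∑ i ∈ T, finrank k ↥(K ⊓ H i) ≤ finrank k K := by
    intro T hT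
    rw [((hH T hT).mono fun i _ => (inf_le_right : K ⊓ H i ≤ H i)).sum_finrank]
    exact Submodule.finrank_mono (Finset.sup_le fun i _ => inf_le_left)
  set S : Finset ι := Finset.univ.filter fun i => finrank k ↥(K ⊓ H i) ≠ 0 with hS
  have hsum : ∑ i ∈ S, finrank k ↥(K ⊓ H i) = ∑ i, finrank k ↥(K ⊓ H i) :=
    Finset.sum_filter_ne_zero _
  rcases le_or_gt S.card 3 with h | h
  · exact hsum ▸ key S h
  · obtain ⟨T, hTS, hT⟩ := Finset.exists_subset_card_eq h.le
    have h1 : T.card ≤ ∑ i ∈ T, finrank k ↥(K ⊓ H i) := by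
      rw [Finset.card_eq_sum_ones]
      exact Finset.sum_le_sum fun i hi =>
        Nat.one_le_iff_ne_zero.mpr (Finset.mem_filter.mp (hTS hi)).2
    have := key T hT.le
    omega

end Subspaces

variable {F : Type*} [Field F] {Fq : Subfield F}

theorem charP_two_of_card_subfield (hq : Nat.card Fq = 2) : CharP F 2 := by
  have h : (2 : Fq) = 0 := by
    have := card_nsmul_eq_zero' (x := (1 : Fq))
    rw [hq] at this
    simpa using this
  refine CharTwo.of_one_ne_zero_of_two_eq_zero one_ne_zero ?_
  exact congrArg (fun x : Fq => (x : F)) h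

theorem finrank_le_one_of_forall_eq (K : Submodule Fq F)
    (h : ∀ x ∈ K, ∀ y ∈ K, x ≠ 0 → y ≠ 0 → x = y) : finrank Fq K ≤ 1 := by
  by_cases hK : K = ⊥
  · rw [hK, finrank_bot]
    exact zero_le_one
  · obtain ⟨x, hx, hx0⟩ := K.ne_bot_iff.mp hK
    refine finrank_le_one (⟨x, hx⟩ : K) fun w => ?_
    by_cases hw : (w : F) = 0
    · exact ⟨0, by ext; simp [hw]⟩
    · exact ⟨1, by ext; simpa using h x hx w w.2 hx0 hw⟩

variable [Finite F]

theorem exists_linearMap_quartic (hq : Nat.card Fq = 2) (a b c : F) :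
    ∃ L : F →ₗ[Fq] F, ∀ x, L x = a * x + b * x ^ 2 + c * x ^ 4 := by
  have := Fintype.ofFinite Fq
  let φ : F →ₗ[Fq] F := (FiniteField.frobeniusAlgHom Fq F).toLinearMap
  have hφ : ∀ x, φ x = x ^ 2 := fun x => by
    change x ^ Fintype.card Fq = x ^ 2
    rw [← Nat.card_eq_fintype_card, hq]
  refine ⟨LinearMap.mulLeft Fq a + LinearMap.mulLeft Fq b ∘ₗ φ
    + LinearMap.mulLeft Fq c ∘ₗ φ ∘ₗ φ, fun x => ?_⟩
  simp only [LinearMap.add_apply, LinearMap.comp_apply, LinearMap.mulLeft_apply, hφ]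
  ring

theorem pow_three_injective {m : ℕ} (hm : Odd m) (hF : Nat.card F = 2 ^ m) {x y : F}
    (hy : y ≠ 0) (h : x ^ 3 = y ^ 3) : x = y := by
  have hz : (x / y) ^ 3 = 1 := by rw [div_pow, h, div_self (pow_ne_zero 3 hy)]
  have hz0 : x / y ≠ 0 := by
    intro h0
    simp [h0] at hz
  have hcard : (x / y) ^ (2 ^ m - 1) = 1 := by
    have := Fintype.ofFinite F
    rw [← hF, Nat.card_eq_fintype_card]
    exact FiniteField.pow_card_sub_one_eq_one _ hz0
  obtain ⟨k, rfl⟩ := hm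
  have hmod : ∃ t, 2 ^ (2 * k + 1) - 1 = 3 * t + 1 := by
    have h4 : 4 ^ k % 3 = 1 := by simp [Nat.pow_mod]
    refine ⟨2 * (4 ^ k / 3), ?_⟩
    rw [pow_succ, pow_mul]
    norm_num
    omega
  obtain ⟨t, ht⟩ := hmod
  rw [ht, pow_succ, pow_mul, hz, one_pow, one_mul] at hcard
  exact (div_eq_one_iff_eq hy).mp hcard

theorem sq_add_self_add_one_ne_zero {m : ℕ} (hm : Odd m) (hF : Nat.card F = 2 ^ m)
    [CharP F 2] (x : F) : x ^ 2 + x + 1 ≠ 0 := by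
  intro h
  have h3 : x ^ 3 = 1 ^ 3 := by linear_combination (x - 1) * h
  have h1 := pow_three_injective hm hF one_ne_zero h3
  have h2 : (2 : F) = 0 := CharTwo.two_eq_zero
  have : (1 : F) = 0 := by
    rw [h1] at h
    linear_combination h - h2
  exact one_ne_zero this

theorem finrank_ker_quartic_lt_weight [DecidableEq F] {m : ℕ} (hm : Odd m)
    (hq : Nat.card Fq = 2) (hF : Nat.card F = 2 ^ m) {a b c : F}
    (h0 : ¬ (a = 0 ∧ b = 0 ∧ c = 0)) (L : F →ₗ[Fq] F)
    (hL : ∀ x, L x = a * x + b * x ^ 2 + c * x ^ 4) :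
    finrank Fq (LinearMap.ker L) + 1 ≤ hammingNorm ![a, b, c] := by
  have : CharP F 2 := charP_two_of_card_subfield hq
  have hw : hammingNorm ![a, b, c] =
      (if a ≠ 0 then 1 else 0) + (if b ≠ 0 then 1 else 0) + (if c ≠ 0 then 1 else 0) := by
    rw [hammingNorm, Finset.card_filter, Fin.sum_univ_three]
    rfl
  have hker : ∀ x ∈ LinearMap.ker L, a * x + b * x ^ 2 + c * x ^ 4 = 0 := fun x hx => by
    rw [← hL]; exact hx
  have bot : (∀ x ∈ LinearMap.ker L, x = 0) → finrank Fq (LinearMap.ker L) = 0 := fun h => by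
    rw [(Submodule.eq_bot_iff _).mpr h, finrank_bot]
  have one := finrank_le_one_of_forall_eq (LinearMap.ker L)
  rw [hw]
  by_cases ha : a = 0 <;> by_cases hb : b = 0 <;> by_cases hc : c = 0
  · exact absurd ⟨ha, hb, hc⟩ h0
  · have := bot fun x hx => by simpa [ha, hb, hc] using hker x hx
    grind
  · have := bot fun x hx => by simpa [ha, hb, hc] using hker x hx
    grind
  · have := one fun x hx y hy hx0 hy0 => by
      have ex : b + c * x ^ 2 = 0 :=
        mul_left_cancel₀ (pow_ne_zero 2 hx0) (by linear_combination hker x hx - x * ha)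
      have ey : b + c * y ^ 2 = 0 :=
        mul_left_cancel₀ (pow_ne_zero 2 hy0) (by linear_combination hker y hy - y * ha)
      have : x ^ 2 = y ^ 2 := mul_left_cancel₀ hc (by linear_combination ex - ey)
      exact CharTwo.sq_injective this
    grind
  · have := bot fun x hx => by simpa [ha, hb, hc] using hker x hx
    grind
  · have := one fun x hx y hy hx0 hy0 => by
      have ex : a + c * x ^ 3 = 0 :=
        mul_left_cancel₀ hx0 (by linear_combination hker x hx - x ^ 2 * hb)
      have ey : a + c * y ^ 3 = 0 :=
        mul_left_cancel₀ hy0 (by linear_combination hker y hy - y ^ 2 * hb)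
      exact pow_three_injective hm hF hy0
        (mul_left_cancel₀ hc (by linear_combination ex - ey))
    grind
  · have := one fun x hx y hy hx0 hy0 => by
      have ex : a + b * x = 0 :=
        mul_left_cancel₀ hx0 (by linear_combination hker x hx - x ^ 4 * hc)
      have ey : a + b * y = 0 :=
        mul_left_cancel₀ hy0 (by linear_combination hker y hy - y ^ 4 * hc)
      exact mul_left_cancel₀ hb (by linear_combination ex - ey)
    grind
  · have hcard : Nat.card (LinearMap.ker L) ≤ 4 := by
      open Polynomial in
      let p : F[X] := C c * X ^ 4 + C b * X ^ 2 + C a * X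
      have hdeg : p.natDegree ≤ 4 := by
        simp only [p]
        compute_degree
      have hp : p ≠ 0 := by
        intro hp
        have := congrArg (fun f : F[X] => f.coeff 1) hp
        simp [p, coeff_X_pow, ha] at this
      have hsub : (LinearMap.ker L : Set F) ⊆ (p.roots.toFinset : Set F) := by
        intro x hx
        rw [Finset.mem_coe, Multiset.mem_toFinset, mem_roots hp, IsRoot.def]
        simp only [p, eval_add, eval_mul, eval_C, eval_pow, eval_X]
        linear_combination hker x hx
      calc Nat.card (LinearMap.ker L) = (LinearMap.ker L : Set F).ncard := rfl
        _ ≤ (p.roots.toFinset : Set F).ncard := Set.ncard_le_ncard hsub (Finset.finite_toSet _)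
        _ = p.roots.toFinset.card := Set.ncard_coe_finset _
        _ ≤ p.roots.card := Multiset.toFinset_card_le _
        _ ≤ 4 := (card_roots' p).trans hdeg
    have : finrank Fq (LinearMap.ker L) ≤ 2 := by
      rw [Module.natCard_eq_pow_finrank (K := Fq), hq] at hcard
      exact (Nat.pow_le_pow_iff_right (le_refl 2)).mp (hcard.trans (by norm_num))
    grind

/-- The quartic `x⁴ + (t + 1) x² + t x = x (x + 1) (x² + x + t)`, for suitable `t ∉ {0, 1}`, has
only the roots `0` and `1`. -/
theorem exists_quartic_finrank_ker_le_one {m : ℕ} (hm3 : 3 ≤ m) (hm : Odd m)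
    (hq : Nat.card Fq = 2) (hF : Nat.card F = 2 ^ m) :
    ∃ a b : F, a ≠ 0 ∧ b ≠ 0 ∧ ∀ L : F →ₗ[Fq] F,
      (∀ x, L x = a * x + b * x ^ 2 + 1 * x ^ 4) → finrank Fq (LinearMap.ker L) ≤ 1 := by
  have : CharP F 2 := charP_two_of_card_subfield hq
  have h2 : (2 : F) = 0 := CharTwo.two_eq_zero
  have hne := sq_add_self_add_one_ne_zero hm hF
  obtain ⟨y, hy0, hy1⟩ : ∃ y : F, y ≠ 0 ∧ y ≠ 1 := by
    by_contra! h
    have hsub : (Set.univ : Set F) ⊆ {0, 1} := fun y _ => by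
      by_cases hy : y = 0
      · simp [hy]
      · simp [h y hy]
    have h1 := Set.ncard_le_ncard hsub (Set.toFinite _)
    have h3 : 2 ^ 3 ≤ 2 ^ m := Nat.pow_le_pow_right (by norm_num) hm3
    rw [Set.ncard_univ, hF, Set.ncard_pair zero_ne_one] at h1
    omega
  have hyy : y ^ 2 + y ≠ 0 := by
    intro h
    rcases mul_eq_zero.mp (show y * (y - 1) = 0 by linear_combination h - y * h2) with h | h
    · exact hy0 h
    · exact hy1 (sub_eq_zero.mp h)
  refine ⟨y ^ 2 + y + 1, y ^ 2 + y, hne y, hyy, fun L hL => ?_⟩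
  have hone : ∀ x ∈ LinearMap.ker L, x ≠ 0 → x = 1 := by
    intro x hx hx0
    have hx' : (y ^ 2 + y + 1) * x + (y ^ 2 + y) * x ^ 2 + 1 * x ^ 4 = 0 := by
      rw [← hL]; exact hx
    have h : (x - 1) * ((x + y) ^ 2 + (x + y) + 1) = 0 := by
      apply mul_left_cancel₀ hx0
      linear_combination hx' + (x ^ 3 * y - x ^ 2 * y - x * (y ^ 2 + y + 1)) * h2
    exact sub_eq_zero.mp ((mul_eq_zero.mp h).resolve_right (hne _))
  exact finrank_le_one_of_forall_eq _ fun x hx z hz hx0 hz0 =>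
    (hone x hx hx0).trans (hone z hz hz0).symm

theorem srWt1_map_add_sum_finrank {g r : ℕ} (β : Fin g → Fin r → F)
    (hdim : ∀ i, finrank Fq (Submodule.span Fq (Set.range (β i))) = r) (L : F →ₗ[Fq] F) :
    srWt1 Fq (fun i u => L (β i u))
      + ∑ i, finrank Fq ↥(LinearMap.ker L ⊓ Submodule.span Fq (Set.range (β i))) = g * r := by
  have h : ∀ i, rkWt Fq (fun u => L (β i u))
      + finrank Fq ↥(LinearMap.ker L ⊓ Submodule.span Fq (Set.range (β i))) = r := fun i => by
    have h := finrank_map_add_finrank_ker_inf L (Submodule.span Fq (Set.range (β i)))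
    rwa [Submodule.map_span, ← Set.range_comp, hdim i] at h
  rw [srWt1, ← Finset.sum_add_distrib, Finset.sum_congr rfl fun i _ => h i]
  simp

end LinearizedQuartic

/-- **Proposition (binary triply extended MSRD codes are not one-weight).**  Let `q = 2`, let
`m ≥ 3` be odd and `n = μr`.  Let `β : [μ] × [r] → F_{2^m}` be such that the subspaces
`H i = ⟨β i 1, ..., β i r⟩_{F_2}` satisfy `dim H i = r` and `H i ∩ (Σ_{j ∈ Γ} H j) = 0` for
`Γ ⊆ [μ]` with `i ∉ Γ` and `|Γ| ≤ min{3, μ} - 1`.  The triply extended code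
`C_e ⊆ F_{2^m}^{n+3}` generated by `(β₁, ..., β_{μr}, 1, 0, 0)`,
`(β₁², ..., β_{μr}², 0, 1, 0)`, `(β₁⁴, ..., β_{μr}⁴, 0, 0, 1)` is MSRD but not a one-weight
code for the extended sum-rank metric `d_e = d_SR + d_H` (sum-rank over `F_2` for the length
partition `(μ, r)`): `d_e(C_e) = n + 1`, but some nonzero codeword of `C_e` has `d_e`-weight
strictly greater than `n + 1`. -/
theorem binary_triply_extended_MSRD_not_one_weight
    {m μ r : ℕ} (hm3 : 3 ≤ m) (hm : Odd m) (hμ : 1 ≤ μ) (hr : 1 ≤ r)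
    {F : Type*} [Field F] [Finite F] [DecidableEq F]
    (Fq : Subfield F) (hq : Nat.card Fq = 2) (hF : Nat.card F = 2 ^ m)
    (β : Fin μ → Fin r → F)
    (hdim : ∀ i : Fin μ,
      Module.finrank Fq (Submodule.span Fq (Set.range (β i))) = r)
    (hinter : ∀ (i : Fin μ) (Γ : Finset (Fin μ)), i ∉ Γ → Γ.card ≤ min 3 μ - 1 →
      Submodule.span Fq (Set.range (β i)) ⊓
        (Γ.sup fun j => Submodule.span Fq (Set.range (β j))) = ⊥)
    (Ce : Submodule F ((Fin μ → Fin r → F) × (Fin 3 → F)))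
    (hCe : Ce = Submodule.span F
      {x | x = ((fun (j : Fin μ) (u : Fin r) => β j u),
              fun v : Fin 3 => if v = 0 then 1 else 0) ∨
           x = ((fun (j : Fin μ) (u : Fin r) => β j u ^ 2),
              fun v : Fin 3 => if v = 1 then 1 else 0) ∨
           x = ((fun (j : Fin μ) (u : Fin r) => β j u ^ 4),
              fun v : Fin 3 => if v = 2 then 1 else 0)}) :
    minDist (fun c c' : (Fin μ → Fin r → F) × (Fin 3 → F) =>
        srWt1 Fq (c.1 - c'.1) + hammingDist c.2 c'.2) (Ce : Set _)
      = μ * r + 1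
    ∧ ∃ c ∈ Ce, c ≠ 0 ∧ μ * r + 1 < srWt1 Fq c.1 + hammingNorm c.2 := by
  have key : ∀ T : Finset (Fin μ), T.card ≤ 3 →
      T.SupIndep fun i => Submodule.span Fq (Set.range (β i)) := by
    intro T hT t ht i hi hit
    have h1 : t.card < T.card := Finset.card_lt_card ⟨ht, fun h => hit (h hi)⟩
    have h2 : T.card ≤ μ := by simpa using Finset.card_le_univ T
    exact disjoint_iff.mpr (hinter i t hit (by omega))
  have hmem : ∀ x, x ∈ Ce ↔ ∃ a b c : F,
      x = ((fun i u => a * β i u + b * β i u ^ 2 + c * β i u ^ 4), ![a, b, c]) := by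
    intro x
    have hset : ∀ v₀ v₁ v₂ : (Fin μ → Fin r → F) × (Fin 3 → F),
        {x | x = v₀ ∨ x = v₁ ∨ x = v₂} = {v₀, v₁, v₂} := fun _ _ _ => rfl
    rw [hCe, hset, Submodule.mem_span_triple]
    refine exists₃_congr fun a b c => ?_
    rw [eq_comm]
    refine Eq.congr_right ?_
    ext i
    · simp
    · fin_cases i <;> simp
  have hwt : ∀ (a b c : F) (L : F →ₗ[Fq] F), (∀ x, L x = a * x + b * x ^ 2 + c * x ^ 4) →
      Module.finrank Fq (LinearMap.ker L) ≤ 2 →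
      μ * r ≤ srWt1 Fq (fun i u => a * β i u + b * β i u ^ 2 + c * β i u ^ 4)
        + Module.finrank Fq (LinearMap.ker L) := by
    intro a b c L hL hK
    have h1 := srWt1_map_add_sum_finrank β hdim L
    have h2 := sum_finrank_inf_le key (LinearMap.ker L) hK
    simp only [hL] at h1
    omega
  have hlow : ∀ x ∈ Ce, x ≠ 0 → μ * r + 1 ≤ srWt1 Fq x.1 + hammingNorm x.2 := by
    intro x hx hx0
    obtain ⟨a, b, c, rfl⟩ := (hmem x).mp hx
    have h0 : ¬ (a = 0 ∧ b = 0 ∧ c = 0) := by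
      rintro ⟨rfl, rfl, rfl⟩
      apply hx0
      ext i
      · simp
      · fin_cases i <;> simp
    obtain ⟨L, hL⟩ := exists_linearMap_quartic hq a b c
    have h1 := finrank_ker_quartic_lt_weight hm hq hF h0 L hL
    have h2 : hammingNorm ![a, b, c] ≤ 3 := by
      simpa using hammingNorm_le_card_fintype (x := ![a, b, c])
    have h3 := hwt a b c L hL (by omega)
    dsimp only
    omega
  refine ⟨le_antisymm (Nat.sInf_le ?_) (le_csInf ?_ ?_), ?_⟩
  · refine ⟨(β, ![1, 0, 0]), (hmem _).mpr ⟨1, 0, 0, by simp⟩, 0, Ce.zero_mem, ?_, ?_⟩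
    · intro h
      simpa using congrFun (congrArg Prod.snd h) 0
    · have h1 : srWt1 Fq β = μ * r := by
        rw [srWt1, Finset.sum_congr rfl fun i _ => show rkWt Fq (β i) = r from hdim i]
        simp
      have h2 : hammingNorm ![(1 : F), 0, 0] = 1 := by
        rw [hammingNorm, Finset.card_filter, Fin.sum_univ_three]
        simp
      simp [h1, h2]
  · exact ⟨_, (β, ![1, 0, 0]), (hmem _).mpr ⟨1, 0, 0, by simp⟩, 0, Ce.zero_mem,
      fun h => by simpa using congrFun (congrArg Prod.snd h) 0, rfl⟩
  · rintro _ ⟨x, hx, y, hy, hxy, rfl⟩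
    have := hlow (x - y) (Ce.sub_mem hx hy) (sub_ne_zero.mpr hxy)
    rwa [Prod.snd_sub, sub_eq_neg_add x.2, ← hammingDist_eq_hammingNorm, hammingDist_comm] at this
  · obtain ⟨a, b, ha, hb, hab⟩ := exists_quartic_finrank_ker_le_one hm3 hm hq hF
    obtain ⟨L, hL⟩ := exists_linearMap_quartic hq a b 1
    have hK := hab L hL
    refine ⟨_, (hmem _).mpr ⟨a, b, 1, rfl⟩, ?_, ?_⟩
    · intro h
      simpa using congrFun (congrArg Prod.snd h) 2
    · have h1 := hwt a b 1 L hL (by omega)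
      have h2 : hammingNorm ![a, b, 1] = 3 := by
        rw [hammingNorm, Finset.card_filter, Fin.sum_univ_three]
        simp [ha, hb]
      dsimp only
      omega
end

section
/- Let wt_i be a weight function on F_q^{n_i} with associated metric d_i, for i in [ℓ], and let n = n_1 + ... + n_ℓ. Define the sum weight wt_sum(c) = wt_1(c_1) + ... + wt_ℓ(c_ℓ) for c = (c_1,...,c_ℓ) in F_q^n with c_i in F_q^{n_i}, and let d_sum be its associated metric. If each metric d_i satisfies the Singleton bound on F_q^{n_i}, then d_sum satisfies the Singleton bound on F_q^n: for every code C ⊆ F_q^n with |C| ≥ 2, d_sum(C) ≤ n − log_q|C| + 1. -/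
/-- The Singleton bound for a distance function `d` in multiplicative form: a code with at least
two elements, any two of them more than `k` apart, satisfies `#C * q ^ k ≤ q ^ n`. -/
def IsSingletonBounded {V : Type*} (q n : ℕ) (d : V → V → ℕ) : Prop :=
  ∀ (k : ℕ) (C : Finset V), 2 ≤ C.card → (∀ u ∈ C, ∀ v ∈ C, u ≠ v → k < d u v) →
    C.card * q ^ k ≤ q ^ n

lemma IsSingletonBounded.dist_le {V : Type*} {q n : ℕ} {d : V → V → ℕ} (hq : 0 < q)
    (h : IsSingletonBounded q n d) (hd_self : ∀ v, d v v = 0) (hd_symm : ∀ u v, d u v = d v u)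
    (u v : V) : d u v ≤ n := by
  classical
  by_contra! hlt
  have huv : u ≠ v := by
    rintro rfl
    simp [hd_self] at hlt
  have hpair := h n {u, v} (Finset.card_pair huv).ge (by
    simp only [Finset.mem_insert, Finset.mem_singleton]
    rintro a (rfl | rfl) b (rfl | rfl) hab
    · exact absurd rfl hab
    · exact hlt
    · rwa [hd_symm]
    · exact absurd rfl hab)
  rw [Finset.card_pair huv] at hpair
  have := pow_pos hq n
  lia

/-- If the required distance is at most the length of the first factor, bound the fibres of the
second projection; otherwise the second projection is injective on the code. -/
lemma IsSingletonBounded.prod {V W : Type*} [Finite W] {q m n : ℕ} {d : V → V → ℕ}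
    {e : W → W → ℕ} (hq : 0 < q) (hd : IsSingletonBounded q m d) (he : IsSingletonBounded q n e)
    (hW : Nat.card W ≤ q ^ n) (hd_self : ∀ v, d v v = 0) (hd_symm : ∀ u v, d u v = d v u)
    (he_self : ∀ w, e w w = 0) :
    IsSingletonBounded q (m + n) (fun x y : V × W => d x.1 y.1 + e x.2 y.2) := by
  classical
  have := Fintype.ofFinite W
  intro k C hC hdist
  rcases le_total k m with hkm | hmk
  · have hfibre : ∀ w ∈ C.image Prod.snd, (C.filter (fun x => x.2 = w)).card ≤ q ^ (m - k) := by
      intro w _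
      have hinj : Set.InjOn Prod.fst (C.filter (fun x => x.2 = w) : Set (V × W)) := by
        intro x hx y hy hxy
        simp only [Finset.coe_filter, Set.mem_ofPred_eq] at hx hy
        exact Prod.ext hxy (hx.2.trans hy.2.symm)
      rw [← Finset.card_image_of_injOn hinj]
      set F := (C.filter (fun x => x.2 = w)).image Prod.fst with hF
      rcases lt_or_ge F.card 2 with hlt | hge
      · have := pow_pos hq (m - k)
        lia
      · have hbound := hd k F hge (by
          simp only [hF, Finset.mem_image, Finset.mem_filter]
          rintro _ ⟨x, ⟨hx, hxw⟩, rfl⟩ _ ⟨y, ⟨hy, hyw⟩, rfl⟩ hxy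
          have := hdist x hx y hy (fun h => hxy (congrArg Prod.fst h))
          simpa [hxw, hyw, he_self] using this)
        refine Nat.le_of_mul_le_mul_right ?_ (pow_pos hq k)
        rwa [← pow_add, Nat.sub_add_cancel hkm]
    calc C.card * q ^ k
        ≤ (q ^ (m - k) * (C.image Prod.snd).card) * q ^ k :=
          Nat.mul_le_mul_right _ (Finset.card_le_mul_card_image C _ hfibre)
      _ ≤ (q ^ (m - k) * q ^ n) * q ^ k := by
          gcongr
          exact (Finset.card_le_univ _).trans (by rwa [← Nat.card_eq_fintype_card])
      _ = q ^ (m + n) := by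
          rw [← pow_add, ← pow_add]
          congr 1
          lia
  · have hsnd : ∀ x ∈ C, ∀ y ∈ C, x ≠ y → k - m < e x.2 y.2 := by
      intro x hx y hy hxy
      have h₁ := hdist x hx y hy hxy
      have h₂ := hd.dist_le hq hd_self hd_symm x.1 y.1
      lia
    have hinj : Set.InjOn Prod.snd (C : Set (V × W)) := by
      intro x hx y hy hxy
      by_contra hne
      have := hsnd x hx y hy hne
      simp [hxy, he_self] at this
    have hcard := Finset.card_image_of_injOn hinj
    have hbound := he (k - m) (C.image Prod.snd) (by rwa [hcard]) (by
      simp only [Finset.mem_image]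
      rintro _ ⟨x, hx, rfl⟩ _ ⟨y, hy, rfl⟩ hxy
      exact hsnd x hx y hy (fun h => hxy (congrArg Prod.snd h)))
    rw [hcard] at hbound
    calc C.card * q ^ k = q ^ m * (C.card * q ^ (k - m)) := by
          rw [← mul_left_comm, ← pow_add, Nat.add_sub_cancel' hmk]
      _ ≤ q ^ m * q ^ n := by gcongr
      _ = q ^ (m + n) := (pow_add _ _ _).symm

lemma IsSingletonBounded.of_injective {V W : Type*} {q n : ℕ} {d : V → V → ℕ}
    {e : W → W → ℕ} (h : IsSingletonBounded q n e) (f : V → W) (hf : f.Injective)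
    (hde : ∀ u v, d u v = e (f u) (f v)) : IsSingletonBounded q n d := by
  intro k C hC hdist
  have hbound := h k (C.map ⟨f, hf⟩) (by rwa [Finset.card_map]) (by
    simp only [Finset.mem_map, Function.Embedding.coeFn_mk]
    rintro _ ⟨x, hx, rfl⟩ _ ⟨y, hy, rfl⟩ hxy
    rw [← hde]
    exact hdist x hx y hy (fun h => hxy (congrArg f h)))
  rwa [Finset.card_map] at hbound

lemma IsSingletonBounded.pi {q l : ℕ} (hq : 0 < q) {V : Fin l → Type*} [∀ i, Finite (V i)]
    {n : Fin l → ℕ} {d : ∀ i, V i → V i → ℕ} (hd : ∀ i, IsSingletonBounded q (n i) (d i))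
    (hV : ∀ i, Nat.card (V i) ≤ q ^ n i) (hd_self : ∀ i v, d i v v = 0)
    (hd_symm : ∀ i u v, d i u v = d i v u) :
    IsSingletonBounded q (∑ i, n i) (fun u v : ∀ i, V i => ∑ i, d i (u i) (v i)) := by
  induction l with
  | zero =>
    intro k C hC _
    have := Finset.card_le_one_of_subsingleton C
    lia
  | succ l ih =>
    have htail := ih (fun i => hd i.succ) (fun i => hV i.succ) (fun i => hd_self i.succ)
      (fun i => hd_symm i.succ)
    have hcard : Nat.card (∀ i : Fin l, V i.succ) ≤ q ^ ∑ i : Fin l, n i.succ := by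
      rw [Nat.card_pi, ← Finset.prod_pow_eq_pow_sum]
      exact Finset.prod_le_prod' fun i _ => hV i.succ
    rw [Fin.sum_univ_succ]
    exact ((hd 0).prod hq htail hcard (hd_self 0) (hd_symm 0) (by simp [hd_self])).of_injective
      (Fin.consEquiv V).symm (Fin.consEquiv V).symm.injective
      (fun u v => by simp [Fin.sum_univ_succ, Fin.consEquiv, Fin.tail])

/-- The minimum distance of a code with two distinct elements is attained. -/
lemma exists_eq_minDist {V : Type*} (d : V → V → ℕ) {C : Set V} (hC : C.Nontrivial) :
    ∃ u ∈ C, ∃ v ∈ C, u ≠ v ∧ minDist d C = d u v := by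
  obtain ⟨u, hu, v, hv, huv⟩ := hC
  exact Nat.sInf_mem (s := {x | ∃ c ∈ C, ∃ c' ∈ C, c ≠ c' ∧ x = d c c'})
    ⟨d u v, u, hu, v, hv, huv, rfl⟩

lemma minDist_le_s12 {V : Type*} (d : V → V → ℕ) {C : Set V} {u v : V} (hu : u ∈ C) (hv : v ∈ C)
    (huv : u ≠ v) : minDist d C ≤ d u v :=
  Nat.sInf_le ⟨u, hu, v, hv, huv, rfl⟩

/-- The multiplicative and the logarithmic form of the Singleton inequality agree. -/
lemma mul_pow_le_pow_iff_logb {q a k n : ℕ} (hq : 1 < q) (ha : 0 < a) :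
    a * q ^ k ≤ q ^ n ↔ (k : ℝ) ≤ (n : ℝ) - Real.logb q a := by
  have hq' : (1 : ℝ) < q := by exact_mod_cast hq
  have hq₀ : (0 : ℝ) < q := by positivity
  have ha' : (0 : ℝ) < a := by exact_mod_cast ha
  rw [← Nat.cast_le (α := ℝ), ← Real.logb_le_logb hq' (by positivity) (by positivity)]
  push_cast
  rw [Real.logb_mul ha'.ne' (by positivity), Real.logb_pow, Real.logb_pow,
    Real.logb_self_eq_one hq', mul_one, mul_one, le_sub_iff_add_le']

lemma isSingletonBounded_of_minDist_le {V : Type*} {q n : ℕ} (hq : 1 < q) (d : V → V → ℕ)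
    (h : ∀ C : Set V, 2 ≤ Nat.card C →
      (minDist d C : ℝ) ≤ (n : ℝ) - Real.logb q (Nat.card C) + 1) :
    IsSingletonBounded q n d := by
  intro k C hC hdist
  have hbound := h C (by simpa using hC)
  obtain ⟨u, hu, v, hv, huv, hmin⟩ := exists_eq_minDist d (C := (C : Set V))
    (Finset.one_lt_card_iff_nontrivial.mp hC)
  have hk : ((k + 1 : ℕ) : ℝ) ≤ d u v := by exact_mod_cast hdist u hu v hv huv
  rw [mul_pow_le_pow_iff_logb hq (by lia)]
  rw [hmin] at hbound
  simp only [Nat.card_eq_fintype_card, Finset.coe_sort_coe, Fintype.card_coe] at hbound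
  push_cast at hk
  linarith

lemma IsSingletonBounded.minDist_le {V : Type*} [Finite V] {q n : ℕ} (hq : 1 < q)
    {d : V → V → ℕ} (h : IsSingletonBounded q n d) (hd_pos : ∀ u v, u ≠ v → 0 < d u v)
    (C : Set V) (hC : 2 ≤ Nat.card C) :
    (minDist d C : ℝ) ≤ (n : ℝ) - Real.logb q (Nat.card C) + 1 := by
  classical
  have := Fintype.ofFinite V
  have hcard : C.toFinset.card = Nat.card C := by
    rw [Set.toFinset_card, Nat.card_eq_fintype_card]
  have hnt : C.Nontrivial := by
    rw [← Set.coe_toFinset C]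
    exact Finset.one_lt_card_iff_nontrivial.mp (by lia)
  obtain ⟨u, -, v, -, huv, hmin⟩ := exists_eq_minDist d hnt
  obtain ⟨k, hk⟩ := Nat.exists_eq_succ_of_ne_zero (hd_pos u v huv).ne'
  have hbound := h k C.toFinset (by lia) (by
    intro a ha b hb hab
    have := _root_.minDist_le_s12 d (Set.mem_toFinset.mp ha) (Set.mem_toFinset.mp hb) hab
    lia)
  rw [hcard, mul_pow_le_pow_iff_logb hq (by lia)] at hbound
  rw [hmin, hk]
  push_cast
  linarith

/-- **The Singleton bound for sums of metrics.**  Let `wt i` be a weight function on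
`F_q^{n i}` with associated metric `d i`, for `i ∈ [ℓ]`, and let `n = n 1 + ... + n ℓ`.
Define the sum weight `wt_sum c = ∑ i, wt i (c i)` on `F_q^n` (identified with the product of
the `F_q^{n i}`), with associated metric `d_sum`.  If each `d i` satisfies the Singleton
bound on `F_q^{n i}`, then `d_sum` satisfies the Singleton bound on `F_q^n`: for every code
`C` with `|C| ≥ 2`, `d_sum(C) ≤ n - log_q |C| + 1`. -/
theorem singleton_bound_of_sum_of_metrics
    {K : Type*} [Field K] [Finite K] {l : ℕ} (n : Fin l → ℕ)
    (wt : ∀ i : Fin l, (Fin (n i) → K) → ℕ)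
    (hwt_zero : ∀ i c, wt i c = 0 ↔ c = 0)
    (hwt_smul : ∀ i (lam : K) c, lam ≠ 0 → wt i (lam • c) = wt i c)
    (hwt_add : ∀ i c d, wt i (c + d) ≤ wt i c + wt i d)
    (hSingleton : ∀ (i : Fin l) (C : Set (Fin (n i) → K)), 2 ≤ Nat.card C →
      (minDist (fun u v : Fin (n i) → K => wt i (u - v)) C : ℝ) ≤
        (n i : ℝ) - Real.logb (Nat.card K) (Nat.card C) + 1)
    (C : Set (∀ i : Fin l, Fin (n i) → K)) (hC : 2 ≤ Nat.card C) :
    (minDist (fun u v : ∀ i : Fin l, Fin (n i) → K => ∑ i, wt i (u i - v i)) C : ℝ) ≤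
      ((∑ i, n i : ℕ) : ℝ) - Real.logb (Nat.card K) (Nat.card C) + 1 := by
  have hq : 1 < Nat.card K := Finite.one_lt_card
  have hsymm : ∀ i u v, wt i (u - v) = wt i (v - u) := fun i u v => by
    rw [← hwt_smul i (-1) (v - u) (by simp), neg_one_smul, neg_sub]
  have hself : ∀ i v, wt i (v - v) = 0 := fun i v => (hwt_zero i _).mpr (sub_self v)
  refine IsSingletonBounded.minDist_le hq (IsSingletonBounded.pi (by lia)
    (d := fun i u v => wt i (u - v))
    (fun i => isSingletonBounded_of_minDist_le hq _ (hSingleton i)) (fun i => ?_) hself hsymm)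
    ?_ C hC
  · simp [Nat.card_fun]
  · intro u v huv
    obtain ⟨i, hi⟩ := Function.ne_iff.mp huv
    exact Finset.sum_pos' (fun _ _ => Nat.zero_le _)
      ⟨i, Finset.mem_univ i, Nat.pos_of_ne_zero fun h => hi (sub_eq_zero.mp ((hwt_zero i _).mp h))⟩
end

section
/- Let a,b,c,d in F_{q^m} be such that none of the pairs (a,c), (b,d), (a,b), (c,d) equals (0,0). Then there exists τ in F_{q^m}^* such that a + τb and c + τd are F_q-linearly dependent (as elements of the F_q-vector space F_{q^m}). -/
theorem LinearIndependent.pair_add_ne_zero {K V : Type*} [Ring K] [Nontrivial K] [AddCommGroup V]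
    [Module K V] {x y : V} (h : LinearIndependent K ![x, y]) : x + y ≠ 0 := by
  intro hxy
  have := LinearIndependent.pair_iff.mp h 1 1 (by simpa using hxy)
  exact one_ne_zero this.1

/-- **Lemma.**  Let `a, b, c, d ∈ F_{q^m}` be such that none of the pairs `(a,c)`, `(b,d)`,
`(a,b)`, `(c,d)` equals `(0,0)`.  Then there exists `τ ∈ F_{q^m}^*` such that `a + τb` and
`c + τd` are `F_q`-linearly dependent. -/
theorem exists_tau_linearly_dependent
    {q m : ℕ} {F : Type*} [Field F] [Finite F]
    (Fq : Subfield F) (hq : Nat.card Fq = q) (hF : Nat.card F = q ^ m)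
    (a b c d : F)
    (hac : (a, c) ≠ (0, 0)) (hbd : (b, d) ≠ (0, 0))
    (hab : (a, b) ≠ (0, 0)) (hcd : (c, d) ≠ (0, 0)) :
    ∃ τ : F, τ ≠ 0 ∧ ¬ LinearIndependent Fq ![a + τ * b, c + τ * d] := by
  suffices h : ∃ τ : F, τ ≠ 0 ∧
      (a + τ * b = 0 ∨ c + τ * d = 0 ∨ (a + τ * b) + (c + τ * d) = 0) by
    obtain ⟨τ, hτ, h⟩ := h
    refine ⟨τ, hτ, fun hli => ?_⟩
    rcases h with h | h | h
    · exact hli.ne_zero 0 h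
    · exact hli.ne_zero 1 h
    · exact hli.pair_add_ne_zero h
  have ratio : ∀ x y : F, x ≠ 0 → y ≠ 0 → ∃ τ : F, τ ≠ 0 ∧ x + τ * y = 0 :=
    fun x y hx hy => ⟨-x / y, div_ne_zero (neg_ne_zero.mpr hx) hy, by field_simp; ring⟩
  simp only [ne_eq, Prod.mk.injEq, not_and] at hac hbd hab hcd
  by_cases ha : a = 0
  · have hb := hab ha
    have hc := hac ha
    by_cases hd : d = 0
    · obtain ⟨τ, hτ, h⟩ := ratio c b hc hb
      exact ⟨τ, hτ, .inr (.inr (by rw [ha, hd]; linear_combination h))⟩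
    · obtain ⟨τ, hτ, h⟩ := ratio c d hc hd
      exact ⟨τ, hτ, .inr (.inl h)⟩
  · by_cases hb : b = 0
    · have hd := hbd hb
      by_cases hc : c = 0
      · obtain ⟨τ, hτ, h⟩ := ratio a d ha hd
        exact ⟨τ, hτ, .inr (.inr (by rw [hb, hc]; linear_combination h))⟩
      · obtain ⟨τ, hτ, h⟩ := ratio c d hc hd
        exact ⟨τ, hτ, .inr (.inl h)⟩
    · obtain ⟨τ, hτ, h⟩ := ratio a b ha hb
      exact ⟨τ, hτ, .inl h⟩
end
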